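/- arXiv:1006.0491 — 3 statements merged into one kernel-verified Lean document; each statement's English description precedes it below -/
import Mathlib

section
/- Let Γ₁, Γ₂ ≤ ℤ^D be subgroups and let X₁ = (X₁,Σ₁,μ₁,T₁), X₂ = (X₂,Σ₂,μ₂,T₂) be ℤ^D-systems such that T_i restricted to Γ_i is the identity for i = 1,2. Then for any joining of X₁ and X₂ (i.e., a ℤ^D-system Y with factor maps π_i : Y → X_i generating the σ-algebra of Y), the lifted σ-algebras π₁^{-1}(Σ₁) and π₂^{-1}(Σ₂) are relatively independent over the lifted partially invariant factors π_i^{-1}(Σ_i^{T_i ↾ (Γ₁+Γ₂)}): that is, for all A₁ ∈ Σ₁ and A₂ ∈ Σ₂, ν(π₁^{-1}(A₁) ∩ π₂^{-1}(A₂)) = ∫_Y (E_{μ₁}(1_{A₁}|Σ₁^{T₁↾(Γ₁+Γ₂)})∘π₁)·(E_{μ₂}(1_{A₂}|Σ₂^{T₂↾(Γ₁+Γ₂)})∘π₂) dν. -/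
open MeasureTheory Filter

theorem aux_pull {Ω : Type*} {m m0 : MeasurableSpace Ω} (hm : m ≤ m0) (μ : Measure Ω)
    [IsProbabilityMeasure μ] (f g : Ω → ℝ) (hf : StronglyMeasurable[m] f)
    (hg : Integrable g μ) (hfg : Integrable (fun x => f x * g x) μ) :
    ∫ x, f x * g x ∂μ = ∫ x, f x * (μ[g|m]) x ∂μ := by
  have h := condExp_mul_of_stronglyMeasurable_left (m := m) (μ := μ) hf (g := g) hfg hg
  rw [← integral_condExp hm (f := fun x => f x * g x)]
  exact integral_congr_ae h

theorem aux_one {Ω Y : Type*} (m : MeasurableSpace Y) [mΩ : MeasurableSpace Ω] [mY : MeasurableSpace Y]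
    (ν : Measure Ω) [IsProbabilityMeasure ν] (μ : Measure Y) [IsProbabilityMeasure μ]
    (π : Ω → Y) (hπ : Measurable π) (hmap : ν.map π = μ)
    {G : Type*} [AddCommGroup G] (Γ₁ Γ₂ : AddSubgroup G) (T : G → Y → Y) (R : G → Ω → Ω)
    (hT0 : T 0 = id) (hTadd : ∀ a b, T (a + b) = T a ∘ T b)
    (hT : ∀ a, MeasurePreserving (T a) μ μ) (hR : ∀ a, MeasurePreserving (R a) ν ν)
    (hπR : ∀ a x, π (R a x) = T a (π x))
    (hΓ₂ : ∀ g ∈ Γ₂, T g = id)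
    (F : Ω → ℝ) (hF : Measurable F) (hFb : ∀ᵐ x ∂ν, |F x| ≤ 1)
    (hFR : ∀ g ∈ Γ₁, ∀ x, F (R g x) = F x)
    (hm_le : m ≤ mY)
    (hm : ∀ A : Set Y, MeasurableSet[m] A ↔
      (MeasurableSet[mY] A ∧ ∀ g ∈ Γ₁ ⊔ Γ₂, μ (symmDiff A (T g ⁻¹' A)) = 0))
    (h : Y → ℝ) (hh : Measurable h) (hb : ∀ᵐ y ∂μ, |h y| ≤ 1) :
    ∫ x, F x * h (π x) ∂ν = ∫ x, F x * (μ[h|m]) (π x) ∂ν := by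
  have hFi : Integrable F ν :=
    Integrable.of_bound hF.aestronglyMeasurable 1 (by simpa using hFb)
  have hle : mY.comap π ≤ mΩ := hπ.comap_le
  have hmp : MeasurePreserving π ν μ := ⟨hπ, hmap⟩
  obtain ⟨φ, hφ, hφe⟩ :=
    (stronglyMeasurable_condExp (m := mY.comap π) (μ := ν) (f := F)).measurable.exists_eq_measurable_comp
  have hφe' : ∀ x, (ν[F|mY.comap π]) x = φ (π x) := fun x => congrFun hφe x
  have hφi : Integrable φ μ := by
    rw [← hmp.integrable_comp hφ.aestronglyMeasurable, ← hφe]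
    exact integrable_condExp
  -- key identity
  have key : ∀ k : Y → ℝ, Measurable k → (∀ᵐ y ∂μ, |k y| ≤ 1) →
      ∫ x, F x * k (π x) ∂ν = ∫ y, φ y * k y ∂μ := by
    intro k hk hkb
    have hkb' : ∀ᵐ x ∂ν, |k (π x)| ≤ 1 := hmp.quasiMeasurePreserving.ae hkb
    have h1 := aux_pull hle ν (fun x => k (π x)) F
      (hk.comp (comap_measurable π)).stronglyMeasurable hFi
      (hFi.bdd_mul (hk.comp hπ).aestronglyMeasurable (c := 1) (by simpa using hkb'))
    rw [← hmap, integral_map (f := fun y => φ y * k y) hπ.aemeasurable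
      (hφ.mul hk).aestronglyMeasurable]
    simp only [hφe'] at h1
    simp only [mul_comm (F _), mul_comm (φ _)]
    exact h1
  have keyset : ∀ B, MeasurableSet B → ∫ x in π ⁻¹' B, F x ∂ν = ∫ y in B, φ y ∂μ := by
    intro B hB
    have := key (B.indicator fun _ => 1) (measurable_const.indicator hB)
      (Eventually.of_forall fun y => by by_cases hy : y ∈ B <;> simp [hy])
    rw [← integral_indicator hB, ← integral_indicator (hπ hB)]
    convert this using 2
    · ext x; by_cases hx : π x ∈ B <;> simp [hx, Set.indicator]
    · ext x; by_cases hx : x ∈ B <;> simp [hx]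
  have inv1 : ∀ g ∈ Γ₁, (fun y => φ (T g y)) =ᵐ[μ] φ := by
    intro g hg
    refine Integrable.ae_eq_of_forall_setIntegral_eq _ _
      ((hT g).integrable_comp_of_integrable hφi) hφi ?_
    intro B hB _
    have hC : MeasurableSet (T (-g) ⁻¹' B) := (hT (-g)).measurable hB
    have hBC : B = T g ⁻¹' (T (-g) ⁻¹' B) := by
      rw [← Set.preimage_comp, ← hTadd]; simp [hT0]
    generalize T (-g) ⁻¹' B = C at hC hBC
    subst hBC
    rw [← keyset _ hB]
    have e1 : ∫ y in C, φ y ∂μ = ∫ y in T g ⁻¹' C, φ (T g y) ∂μ := by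
      conv_lhs => rw [← (hT g).map_eq]
      exact setIntegral_map hC hφ.aestronglyMeasurable (hT g).measurable.aemeasurable
    have e2 : ∫ x in π ⁻¹' C, F x ∂ν = ∫ x in R g ⁻¹' (π ⁻¹' C), F (R g x) ∂ν := by
      conv_lhs => rw [← (hR g).map_eq]
      exact setIntegral_map (hπ hC) hF.aestronglyMeasurable (hR g).measurable.aemeasurable
    have e3 : R g ⁻¹' (π ⁻¹' C) = π ⁻¹' (T g ⁻¹' C) := by
      ext x; simp [hπR]
    simp only [hFR g hg, e3] at e2
    rw [← e1, ← e2, keyset _ hC]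
  have inv : ∀ g ∈ Γ₁ ⊔ Γ₂, (fun y => φ (T g y)) =ᵐ[μ] φ := by
    intro g hg
    obtain ⟨a, ha, b, hb, rfl⟩ := AddSubgroup.mem_sup.1 hg
    rw [hTadd, hΓ₂ b hb]
    exact inv1 a ha
  have hφm : Measurable[m] φ := by
    intro B hB
    rw [hm]
    refine ⟨hφ hB, fun g hg => ?_⟩
    rw [measure_symmDiff_eq_zero_iff]
    filter_upwards [inv g hg] with y hy
    apply propext
    change φ y ∈ B ↔ φ (T g y) ∈ B
    rw [hy]
  have hhi : Integrable h μ :=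
    Integrable.of_bound hh.aestronglyMeasurable 1 (by simpa using hb)
  rw [key h hh hb, key _ (stronglyMeasurable_condExp.mono hm_le).measurable
    (ae_bdd_abs_condExp_of_ae_bdd_abs hb)]
  exact aux_pull hm_le μ φ h hφm.stronglyMeasurable hhi
    (hφi.mul_bdd hh.aestronglyMeasurable (c := 1) (by simpa using hb))

theorem aux_main
    {X₁ X₂ : Type*} (m₁ : MeasurableSpace X₁) (m₂ : MeasurableSpace X₂) [m01 : MeasurableSpace X₁] [m02 : MeasurableSpace X₂]
    (μ₁ : Measure X₁) [IsProbabilityMeasure μ₁]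
    (μ₂ : Measure X₂) [IsProbabilityMeasure μ₂]
    (D : ℕ) (T₁ : (Fin D → ℤ) → X₁ → X₁) (T₂ : (Fin D → ℤ) → X₂ → X₂)
    (hT₁0 : T₁ 0 = id) (hT₁add : ∀ a b, T₁ (a + b) = T₁ a ∘ T₁ b)
    (hT₁mp : ∀ a, MeasurePreserving (T₁ a) μ₁ μ₁)
    (hT₂0 : T₂ 0 = id) (hT₂add : ∀ a b, T₂ (a + b) = T₂ a ∘ T₂ b)
    (hT₂mp : ∀ a, MeasurePreserving (T₂ a) μ₂ μ₂)
    (Γ₁ Γ₂ : AddSubgroup (Fin D → ℤ))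
    (hΓ₁ : ∀ g ∈ Γ₁, T₁ g = id) (hΓ₂ : ∀ g ∈ Γ₂, T₂ g = id)
    (ν : Measure (X₁ × X₂)) [IsProbabilityMeasure ν]
    (hν_inv : ∀ g, ν.map (Prod.map (T₁ g) (T₂ g)) = ν)
    (hν_fst : ν.map Prod.fst = μ₁) (hν_snd : ν.map Prod.snd = μ₂)
    (hm₁_le : m₁ ≤ m01)
    (hm₁ : ∀ A : Set X₁, MeasurableSet[m₁] A ↔
      (MeasurableSet[m01] A ∧ ∀ g ∈ Γ₁ ⊔ Γ₂, μ₁ (symmDiff A (T₁ g ⁻¹' A)) = 0))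
    (hm₂_le : m₂ ≤ m02)
    (hm₂ : ∀ A : Set X₂, MeasurableSet[m₂] A ↔
      (MeasurableSet[m02] A ∧ ∀ g ∈ Γ₁ ⊔ Γ₂, μ₂ (symmDiff A (T₂ g ⁻¹' A)) = 0)) :
    ∀ (A₁ : Set X₁) (A₂ : Set X₂), MeasurableSet[m01] A₁ → MeasurableSet[m02] A₂ →
      (ν (Prod.fst ⁻¹' A₁ ∩ Prod.snd ⁻¹' A₂)).toReal =
        ∫ p, (μ₁[Set.indicator A₁ (fun _ => (1 : ℝ))|m₁]) p.1 *
             (μ₂[Set.indicator A₂ (fun _ => (1 : ℝ))|m₂]) p.2 ∂ν := by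
  intro A₁ A₂ hA₁ hA₂
  have hR : ∀ g, MeasurePreserving (Prod.map (T₁ g) (T₂ g)) ν ν := fun g =>
    ⟨(hT₁mp g).measurable.prodMap (hT₂mp g).measurable, hν_inv g⟩
  have b₁ : ∀ x, |A₁.indicator (fun _ => (1 : ℝ)) x| ≤ 1 := fun y => by
    by_cases hy : y ∈ A₁ <;> simp [hy]
  have b₂ : ∀ x, |A₂.indicator (fun _ => (1 : ℝ)) x| ≤ 1 := fun y => by
    by_cases hy : y ∈ A₂ <;> simp [hy]
  have hi₁ : Measurable[m01] (A₁.indicator (fun _ => (1 : ℝ))) :=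
    measurable_const.indicator hA₁
  have hi₂ : Measurable[m02] (A₂.indicator (fun _ => (1 : ℝ))) :=
    measurable_const.indicator hA₂
  have hc₂ : Measurable[m02] (μ₂[A₂.indicator (fun _ => (1 : ℝ))|m₂]) :=
    (stronglyMeasurable_condExp.mono hm₂_le).measurable
  have hcb : ∀ᵐ x ∂μ₂, |(μ₂[A₂.indicator (fun _ => (1 : ℝ))|m₂]) x| ≤ 1 :=
    ae_bdd_abs_condExp_of_ae_bdd_abs (Eventually.of_forall b₂)
  have s1 := aux_one m₂ (mY := m02) ν μ₂ Prod.snd measurable_snd hν_snd Γ₁ Γ₂ T₂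
    (fun g => Prod.map (T₁ g) (T₂ g)) hT₂0 hT₂add hT₂mp hR (fun _ _ => rfl) hΓ₂
    (fun p => A₁.indicator (fun _ => (1 : ℝ)) p.1) (hi₁.comp measurable_fst)
    (Eventually.of_forall fun p => b₁ p.1) (fun g hg x => by simp [hΓ₁ g hg])
    hm₂_le hm₂ _ hi₂ (Eventually.of_forall b₂)
  have s2 := aux_one m₁ (mY := m01) ν μ₁ Prod.fst measurable_fst hν_fst Γ₂ Γ₁ T₁
    (fun g => Prod.map (T₁ g) (T₂ g)) hT₁0 hT₁add hT₁mp hR (fun _ _ => rfl) hΓ₁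
    (fun p => (μ₂[A₂.indicator (fun _ => (1 : ℝ))|m₂]) p.2) (hc₂.comp measurable_snd)
    ((⟨measurable_snd, hν_snd⟩ : MeasurePreserving Prod.snd ν μ₂).quasiMeasurePreserving.ae
      hcb)
    (fun g hg x => by simp [hΓ₂ g hg])
    hm₁_le (by rw [sup_comm]; exact hm₁) _ hi₁ (Eventually.of_forall b₁)
  have hS : MeasurableSet (Prod.fst ⁻¹' A₁ ∩ Prod.snd ⁻¹' A₂ : Set (X₁ × X₂)) :=
    (measurable_fst hA₁).inter (measurable_snd hA₂)
  have s0 : (ν (Prod.fst ⁻¹' A₁ ∩ Prod.snd ⁻¹' A₂)).toReal =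
      ∫ p, A₁.indicator (fun _ => (1 : ℝ)) p.1 * A₂.indicator (fun _ => (1 : ℝ)) p.2 ∂ν := by
    rw [← measureReal_def, ← integral_indicator_one hS]
    congr 1
    ext p
    by_cases h1 : p.1 ∈ A₁ <;> by_cases h2 : p.2 ∈ A₂ <;> simp [h1, h2, Set.indicator]
  rw [s0, s1]
  exact (integral_congr_ae (Eventually.of_forall fun _ => mul_comm _ _)).trans
    (s2.trans (integral_congr_ae (Eventually.of_forall fun _ => mul_comm _ _)))

/-- **Joinings of partially invariant systems.** If `X₁, X₂` are `ℤ^D`-systems whose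
`Γᵢ`-subactions are trivial, then under any joining `ν` of `X₁` and `X₂` the two
coordinate σ-algebras are relatively independent over the lifted `(Γ₁+Γ₂)`-partially
invariant factors `Σᵢ^{Tᵢ↾(Γ₁+Γ₂)}`. -/
theorem twofold_joining_relatively_independent
    {X₁ X₂ : Type*} [m01 : MeasurableSpace X₁] [m02 : MeasurableSpace X₂]
    (μ₁ : Measure X₁) [IsProbabilityMeasure μ₁]
    (μ₂ : Measure X₂) [IsProbabilityMeasure μ₂]
    (D : ℕ) (T₁ : (Fin D → ℤ) → X₁ → X₁) (T₂ : (Fin D → ℤ) → X₂ → X₂)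
    (hT₁0 : T₁ 0 = id) (hT₁add : ∀ a b, T₁ (a + b) = T₁ a ∘ T₁ b)
    (hT₁mp : ∀ a, MeasurePreserving (T₁ a) μ₁ μ₁)
    (hT₂0 : T₂ 0 = id) (hT₂add : ∀ a b, T₂ (a + b) = T₂ a ∘ T₂ b)
    (hT₂mp : ∀ a, MeasurePreserving (T₂ a) μ₂ μ₂)
    (Γ₁ Γ₂ : AddSubgroup (Fin D → ℤ))
    (hΓ₁ : ∀ g ∈ Γ₁, T₁ g = id) (hΓ₂ : ∀ g ∈ Γ₂, T₂ g = id)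
    (ν : Measure (X₁ × X₂)) [IsProbabilityMeasure ν]
    (hν_inv : ∀ g, ν.map (Prod.map (T₁ g) (T₂ g)) = ν)
    (hν_fst : ν.map Prod.fst = μ₁) (hν_snd : ν.map Prod.snd = μ₂)
    (m₁ : MeasurableSpace X₁) (hm₁_le : m₁ ≤ m01)
    (hm₁ : ∀ A : Set X₁, MeasurableSet[m₁] A ↔
      (MeasurableSet[m01] A ∧ ∀ g ∈ Γ₁ ⊔ Γ₂, μ₁ (symmDiff A (T₁ g ⁻¹' A)) = 0))
    (m₂ : MeasurableSpace X₂) (hm₂_le : m₂ ≤ m02)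
    (hm₂ : ∀ A : Set X₂, MeasurableSet[m₂] A ↔
      (MeasurableSet[m02] A ∧ ∀ g ∈ Γ₁ ⊔ Γ₂, μ₂ (symmDiff A (T₂ g ⁻¹' A)) = 0)) :
    ∀ (A₁ : Set X₁) (A₂ : Set X₂), MeasurableSet[m01] A₁ → MeasurableSet[m02] A₂ →
      (ν (Prod.fst ⁻¹' A₁ ∩ Prod.snd ⁻¹' A₂)).toReal =
        ∫ p, (μ₁[Set.indicator A₁ (fun _ => (1 : ℝ))|m₁]) p.1 *
             (μ₂[Set.indicator A₂ (fun _ => (1 : ℝ))|m₂]) p.2 ∂ν := by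
  exact aux_main (m01 := m01) (m02 := m02) m₁ m₂ μ₁ μ₂ D T₁ T₂ hT₁0 hT₁add hT₁mp hT₂0 hT₂add hT₂mp Γ₁ Γ₂ hΓ₁ hΓ₂ ν hν_inv
    hν_fst hν_snd hm₁_le hm₁ hm₂_le hm₂
end

section
/- Szemerédi's theorem: For every δ > 0 and k ≥ 1 there exists N₀ ≥ 1 such that for all N ≥ N₀, every subset A ⊆ {1,…,N} with |A| ≥ δN contains a nontrivial k-term arithmetic progression: there exist a ∈ {1,…,N} and n ≥ 1 with {a, a+n, …, a+(k-1)n} ⊆ A. -/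
namespace DHJ
open Combinatorics

open Classical in
noncomputable def ind (P : Prop) : ℝ := if P then 1 else 0

lemma ind_true {P : Prop} (h : P) : ind P = 1 := by simp [ind, h]
lemma ind_false {P : Prop} (h : ¬ P) : ind P = 0 := by simp [ind, h]
lemma ind_nonneg (P : Prop) : 0 ≤ ind P := by unfold ind; split_ifs <;> norm_num
lemma ind_le_one (P : Prop) : ind P ≤ 1 := by unfold ind; split_ifs <;> norm_num
lemma ind_mono {P Q : Prop} (h : P → Q) : ind P ≤ ind Q := by
  by_cases hP : P
  · rw [ind_true hP, ind_true (h hP)]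
  · rw [ind_false hP]; exact ind_nonneg _
lemma ind_and (P Q : Prop) : ind (P ∧ Q) = ind P * ind Q := by
  by_cases hP : P <;> by_cases hQ : Q <;> simp [ind, hP, hQ]
lemma ind_not (P : Prop) : ind (¬ P) = 1 - ind P := by
  by_cases hP : P <;> simp [ind, hP]

/-- average of a function on a finite type -/
noncomputable def av {X : Type} [Finite X] (f : X → ℝ) : ℝ :=
  (@Finset.sum X ℝ _ (@Finset.univ X (Fintype.ofFinite X)) f) / Nat.card X

section av
variable {X Y : Type} [Finite X] [Finite Y]

lemma av_eq {X : Type} [Fintype X] (f : X → ℝ) : av f = (∑ x, f x) / Fintype.card X := by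
  unfold av
  rw [Nat.card_eq_fintype_card]
  congr!

lemma av_add (f g : X → ℝ) : av (fun x => f x + g x) = av f + av g := by
  have := Fintype.ofFinite X
  simp only [av_eq, Finset.sum_add_distrib, add_div]

lemma av_sub (f g : X → ℝ) : av (fun x => f x - g x) = av f - av g := by
  have := Fintype.ofFinite X
  simp only [av_eq, Finset.sum_sub_distrib, sub_div]

lemma av_mul (c : ℝ) (f : X → ℝ) : av (fun x => c * f x) = c * av f := by
  have := Fintype.ofFinite X
  simp only [av_eq, ← Finset.mul_sum, mul_div_assoc]

lemma av_const [Nonempty X] (c : ℝ) : av (fun _ : X => c) = c := by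
  have := Fintype.ofFinite X
  simp only [av_eq, Finset.sum_const, Finset.card_univ, nsmul_eq_mul]
  field_simp

lemma av_mono {f g : X → ℝ} (h : ∀ x, f x ≤ g x) : av f ≤ av g := by
  have := Fintype.ofFinite X
  simp only [av_eq]
  gcongr
  exact h _

lemma av_nonneg {f : X → ℝ} (h : ∀ x, 0 ≤ f x) : 0 ≤ av f := by
  have := Fintype.ofFinite X
  simp only [av_eq]
  have : 0 ≤ ∑ x, f x := Finset.sum_nonneg fun x _ => h x
  positivity

lemma av_le [Nonempty X] {f : X → ℝ} {c : ℝ} (h : ∀ x, f x ≤ c) : av f ≤ c := by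
  calc av f ≤ av (fun _ : X => c) := av_mono h
    _ = c := av_const c

lemma le_av [Nonempty X] {f : X → ℝ} {c : ℝ} (h : ∀ x, c ≤ f x) : c ≤ av f := by
  calc c = av (fun _ : X => c) := (av_const c).symm
    _ ≤ av f := av_mono h

lemma exists_le_of_av [Nonempty X] {f : X → ℝ} {c : ℝ} (h : c ≤ av f) : ∃ x, c ≤ f x := by
  by_contra! hc
  have := Fintype.ofFinite X
  have h1 : ∑ x, f x < ∑ x : X, c := Finset.sum_lt_sum_of_nonempty Finset.univ_nonempty
    fun x _ => hc x
  have h2 : av f < av (fun _ : X => c) := by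
    simp only [av_eq]
    gcongr
  rw [av_const] at h2
  linarith

lemma av_equiv (e : X ≃ Y) (f : Y → ℝ) : av (fun x => f (e x)) = av f := by
  have := Fintype.ofFinite X
  have := Fintype.ofFinite Y
  simp only [av_eq, Fintype.card_congr e]
  rw [Equiv.sum_comp e f]

lemma av_prod (f : X × Y → ℝ) : av f = av (fun x => av (fun y => f (x, y))) := by
  have := Fintype.ofFinite X
  have := Fintype.ofFinite Y
  simp only [av_eq, Fintype.card_prod, Fintype.sum_prod_type, ← Finset.sum_div, Nat.cast_mul]
  rw [div_div, mul_comm]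

lemma av_comm (f : X → Y → ℝ) : av (fun x => av (fun y => f x y)) = av (fun y => av (fun x => f x y)) := by
  have := Fintype.ofFinite X
  have := Fintype.ofFinite Y
  simp only [av_eq, ← Finset.sum_div]
  rw [Finset.sum_comm, div_div, div_div, mul_comm]

lemma av_sum {κ : Type} (s : Finset κ) (f : κ → X → ℝ) :
    av (fun x => ∑ k ∈ s, f k x) = ∑ k ∈ s, av (f k) := by
  have := Fintype.ofFinite X
  simp only [av_eq, ← Finset.sum_div]
  rw [Finset.sum_comm]

lemma single_le_av {f : X → ℝ} (h : ∀ x, 0 ≤ f x) (x : X) : f x / Nat.card X ≤ av f := by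
  have := Fintype.ofFinite X
  simp only [av_eq, Nat.card_eq_fintype_card]
  gcongr
  exact Finset.single_le_sum (f := f) (fun x _ => h x) (Finset.mem_univ x)

lemma av_split {ι I R β : Type} [Finite ι] [Finite I] [Finite R] [Finite β] (e : ι ≃ I ⊕ R)
    (f : (ι → β) → ℝ) :
    av f = av (fun x : I → β => av (fun y : R → β => f (fun i => Sum.elim x y (e i)))) := by
  rw [← av_prod (f := fun p : (I → β) × (R → β) => f (fun i => Sum.elim p.1 p.2 (e i)))]
  have E : ((I → β) × (R → β)) ≃ (ι → β) :=
    ((Equiv.sumArrowEquivProdArrow I R β).symm.trans (Equiv.arrowCongr e.symm (Equiv.refl β)))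
  rw [← av_equiv ((Equiv.sumArrowEquivProdArrow I R β).symm.trans
    (Equiv.arrowCongr e.symm (Equiv.refl β))) f]
  rfl

end av

/-! ### subspaces -/

variable {α β ι η ζ I R : Type}

/-- composition of subspaces -/
def scomp (V : Subspace η β ι) (W : Subspace ζ β η) : Subspace ζ β ι where
  idxFun i := (V.idxFun i).elim Sum.inl W.idxFun
  proper e := by
    obtain ⟨j, hj⟩ := W.proper e
    obtain ⟨i, hi⟩ := V.proper j
    exact ⟨i, by simp [hi, hj]⟩

lemma scomp_apply (V : Subspace η β ι) (W : Subspace ζ β η) (x : ζ → β) :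
    scomp V W x = V (W x) := by
  funext i
  rw [Subspace.apply_def, Subspace.apply_def]
  cases h : V.idxFun i <;> simp [scomp, h, Subspace.apply_def]

/-- extend a subspace by constants on the second part -/
def sext (e : ι ≃ I ⊕ R) (V : Subspace η β I) (y : R → β) : Subspace η β ι where
  idxFun i := Sum.elim V.idxFun (fun r => Sum.inl (y r)) (e i)
  proper d := by
    obtain ⟨j, hj⟩ := V.proper d
    exact ⟨e.symm (Sum.inl j), by simp [hj]⟩

lemma sext_apply (e : ι ≃ I ⊕ R) (V : Subspace η β I) (y : R → β) (x : η → β) :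
    sext e V y x = fun i => Sum.elim (V x) y (e i) := by
  funext i
  rw [Subspace.apply_def]
  cases h : e i <;> simp [sext, h, Subspace.apply_def]

/-- extend by constants on the first part -/
def sext2 (e : ι ≃ I ⊕ R) (x : I → β) (V : Subspace η β R) : Subspace η β ι where
  idxFun i := Sum.elim (fun r => Sum.inl (x r)) V.idxFun (e i)
  proper d := by
    obtain ⟨j, hj⟩ := V.proper d
    exact ⟨e.symm (Sum.inr j), by simp [hj]⟩

lemma sext2_apply (e : ι ≃ I ⊕ R) (x : I → β) (V : Subspace η β R) (y : η → β) :
    sext2 e x V y = fun i => Sum.elim x (V y) (e i) := by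
  funext i
  rw [Subspace.apply_def]
  cases h : e i <;> simp [sext2, h, Subspace.apply_def]

/-- identity -/
def sid : Subspace ι β ι := ⟨Sum.inr, fun i => ⟨i, rfl⟩⟩

lemma sid_apply (x : ι → β) : (sid : Subspace ι β ι) x = x := rfl

/-- add a letter to the alphabet -/
def sup (V : Subspace η α ι) : Subspace η (Option α) ι where
  idxFun i := (V.idxFun i).map some id
  proper e := by
    obtain ⟨i, hi⟩ := V.proper e
    exact ⟨i, by simp [hi]⟩

lemma sup_some (V : Subspace η α ι) (z : η → α) : sup V (fun e => some (z e)) = fun i => some (V z i) := by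
  funext i
  rw [Subspace.apply_def, Subspace.apply_def]
  cases h : V.idxFun i <;> simp [sup, h]

lemma subspace_injective (V : Subspace η β ι) : Function.Injective (fun x => V x) := by
  intro x y h
  funext e
  obtain ⟨i, hi⟩ := V.proper e
  have := congrFun h i
  simpa [Subspace.apply_def, hi] using this

instance [Finite α] [Finite ι] : Finite (Line α ι) :=
  Finite.of_injective (fun l => l.idxFun) (fun a b h => by
    cases a; cases b; simp only at h; subst h; rfl)

instance [Finite α] [Finite ι] [Finite η] : Finite (Subspace η α ι) :=
  Finite.of_injective (fun l => l.idxFun) (fun a b h => by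
    cases a; cases b; simp only at h; subst h; rfl)

def HasLine (A : Set (ι → β)) : Prop := ∃ l : Line β ι, ∀ b, l b ∈ A

lemma HasLine.of_subspace {A : Set (ι → β)} (V : Subspace η β ι) (h : HasLine {x | V x ∈ A}) :
    HasLine A := by
  obtain ⟨l, hl⟩ := h
  obtain ⟨j, hj⟩ := l.proper
  obtain ⟨i, hi⟩ := V.proper j
  refine ⟨⟨fun i => (V.idxFun i).elim some l.idxFun, i, by simp [hi, hj]⟩, fun b => ?_⟩
  have := hl b
  simp only [Set.mem_setOf_eq] at this
  convert this using 1
  funext i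
  rw [Subspace.apply_def]
  cases h : V.idxFun i <;> simp [h, Line.apply_def]

noncomputable def dens [Finite ι] [Finite β] (A : Set (ι → β)) : ℝ := av (fun x => ind (x ∈ A))

lemma dens_le_one [Finite ι] [Finite β] [Nonempty β] (A : Set (ι → β)) : dens A ≤ 1 :=
  av_le fun _ => ind_le_one _
lemma dens_nonneg [Finite ι] [Finite β] (A : Set (ι → β)) : 0 ≤ dens A :=
  av_nonneg fun _ => ind_nonneg _

/-- density Hales-Jewett for given density -/
def Good (β : Type) [Finite β] (δ : ℝ) : Prop :=
  ∃ N : ℕ, ∀ (ι : Type) [Finite ι], N ≤ Nat.card ι → ∀ A : Set (ι → β), δ ≤ dens A → HasLine A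

/-- multidimensional version -/
def MGood (β : Type) [Finite β] (m : ℕ) (δ : ℝ) : Prop :=
  ∃ N : ℕ, ∀ (ι : Type) [Finite ι], N ≤ Nat.card ι → ∀ A : Set (ι → β), δ ≤ dens A →
    ∃ S : Subspace (Fin m) β ι, ∀ x, S x ∈ A

lemma exists_split (ι : Type) [Finite ι] (M N : ℕ) (h : M + N ≤ Nat.card ι) :
    ∃ r : ℕ, N ≤ r ∧ Nonempty (ι ≃ Fin M ⊕ Fin r) := by
  refine ⟨Nat.card ι - M, by omega, ?_⟩
  refine ⟨(Finite.equivFin ι).trans ((finCongr (by omega)).trans finSumFinEquiv.symm)⟩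

end DHJ

namespace DHJ
open Combinatorics
/-! ### Graham-Rothschild for lines -/

lemma blockHJ (α : Type) [Finite α] [Nonempty α] (m : ℕ) : ∀ (κ : Type) [Finite κ],
    ∃ ι : Type, Finite ι ∧ ∀ C : (ι → Option α) → κ, ∃ V : Subspace (Fin m) α ι,
      ∀ x x' : Fin m → Option α, (∀ i, x i = none ↔ x' i = none) → C (sup V x) = C (sup V x') := by
  induction m with
  | zero =>
    intro κ _
    refine ⟨Empty, inferInstance, fun C => ⟨⟨fun i => i.elim, fun e => e.elim0⟩, ?_⟩⟩
    intro x x' _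
    rw [Subsingleton.elim x x']
  | succ m ih =>
    intro κ _
    obtain ⟨ι1, h1, H1⟩ := ih (κ × κ)
    obtain ⟨ι2, h2, H2⟩ := Line.exists_mono_in_high_dimension α ((ι1 → Option α) → κ)
    refine ⟨ι1 ⊕ ι2, inferInstance, fun C => ?_⟩
    obtain ⟨l, c, hl⟩ := H2 (fun z u => C (Sum.elim u (fun j => some (z j))))
    obtain ⟨a0⟩ := ‹Nonempty α›
    obtain ⟨V1, hV1⟩ := H1 (fun u => (C (Sum.elim u (fun j => some (l a0 j))), C (Sum.elim u l.idxFun)))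
    let V : Subspace (Fin (m+1)) α (ι1 ⊕ ι2) :=
      { idxFun := Sum.elim (fun i => (V1.idxFun i).map id Fin.succ)
          (fun j => (l.idxFun j).elim (Sum.inr 0) Sum.inl)
        proper := by
          intro e
          refine Fin.cases ?_ (fun e => ?_) e
          · obtain ⟨j, hj⟩ := l.proper
            exact ⟨Sum.inr j, by simp [hj]⟩
          · obtain ⟨i, hi⟩ := V1.proper e
            exact ⟨Sum.inl i, by simp [hi]⟩ }
    have hV : ∀ x, sup V x = Sum.elim (sup V1 (fun i => x i.succ))
        (fun j => (l.idxFun j).elim (x 0) some) := by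
      intro x
      funext i
      rw [Subspace.apply_def]
      rcases i with i | j
      · simp only [Sum.elim_inl]
        rw [Subspace.apply_def]
        cases h : V1.idxFun i <;> simp [sup, V, h]
      · cases h : l.idxFun j <;> simp [sup, V, h]
    have key : ∀ u a, C (Sum.elim u (fun j => (l.idxFun j).elim (some a) some)) =
        C (Sum.elim u (fun j => some (l a0 j))) := by
      intro u a
      have e1 := congrFun (hl a) u
      have e2 := congrFun (hl a0) u
      simp only at e1 e2
      rw [e2, ← e1]
      congr 2
      funext j
      cases h : l.idxFun j <;> simp [h]
    have key2 : ∀ u, C (Sum.elim u (fun j => (l.idxFun j).elim none some)) =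
        C (Sum.elim u l.idxFun) := by
      intro u
      congr 2
      funext j
      cases h : l.idxFun j <;> simp
    refine ⟨V, fun x x' hx => ?_⟩
    rw [hV, hV]
    have h1 := hV1 (fun i => x i.succ) (fun i => x' i.succ) (fun i => hx _)
    rw [Prod.mk.injEq] at h1
    have h0 := hx 0
    cases hx0 : x 0 with
    | none =>
      rw [h0.1 hx0, key2, key2]
      exact h1.2
    | some a =>
      cases hx0' : x' 0 with
      | none => rw [h0.2 hx0'] at hx0; cases hx0
      | some a' =>
        rw [key, key]
        exact h1.1

def FU {ι : Type} (m : ℕ) (c : (ι → Bool) → Bool) (v : Bool) : Prop :=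
  ∃ s : ι → Option (Fin m), (∀ e, ∃ i, s i = some e) ∧
    ∀ t : Fin m → Bool, (∃ e, t e = true) → c (fun i => (s i).elim false t) = v

lemma FU_zero {ι : Type} (c : (ι → Bool) → Bool) (v : Bool) : FU 0 c v :=
  ⟨fun _ => none, fun e => e.elim0, fun _ ⟨e, _⟩ => e.elim0⟩

lemma FU_step {ι η ι1 : Type} (j : ι1 → η) (hj : Function.Injective j) (m : ℕ) (c : (ι → Bool) → Bool) (v : Bool)
    (S : Subspace (Option η) Bool ι) (hS : ∀ z, c (S z) = v) :
    ∃ c1 : (ι1 → Bool) → Bool, (FU m c1 v → FU (m+1) c v) ∧ ∀ m' v', FU m' c1 v' → FU m' c v' := by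
  classical
  let J : η → Option ι1 := fun d => if h : ∃ e, j e = d then some h.choose else none
  have hJ : ∀ e, J (j e) = some e := by
    intro e
    have h : ∃ e', j e' = j e := ⟨e, rfl⟩
    simp only [J, h, dif_pos]
    exact congrArg some (hj h.choose_spec)
  let c1 : (ι1 → Bool) → Bool := fun u => c (fun i => (S.idxFun i).elim (fun _ => false)
    (fun d => d.elim false (fun d => (J d).elim false u)))
  refine ⟨c1, ?_, ?_⟩
  · rintro ⟨s, hs, h⟩
    refine ⟨fun i => (S.idxFun i).elim (fun b => if b then some 0 else none)
      (fun d => d.elim (some 0) (fun d => (J d).elim none (fun e => (s e).map Fin.succ))), ?_, ?_⟩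
    · intro e
      refine Fin.cases ?_ (fun e => ?_) e
      · obtain ⟨i, hi⟩ := S.proper none
        exact ⟨i, by simp [hi]⟩
      · obtain ⟨i1, h1⟩ := hs e
        obtain ⟨i, hi⟩ := S.proper (some (j i1))
        exact ⟨i, by simp [hi, hJ, h1]⟩
    · intro t ht
      cases h0 : t 0 with
      | true =>
        rw [← hS (fun d => d.elim true (fun d => (J d).elim false (fun e => (s e).elim false (fun f => t f.succ))))]
        congr 1
        funext i
        simp only [Subspace.apply_def]
        rcases S.idxFun i with b | d
        · cases b <;> simp [h0]
        · rcases d with _ | d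
          · simp [h0]
          · simp only [Sum.elim_inr, Option.elim_some]
            rcases J d with _ | e
            · simp
            · simp only [Option.elim_some]
              rcases s e with _ | f <;> simp
      | false =>
        obtain ⟨e, he⟩ := ht
        have : ∃ e : Fin m, t e.succ = true := by
          revert he
          refine Fin.cases ?_ (fun e => ?_) e
          · simp [h0]
          · exact fun h => ⟨e, h⟩
        rw [← h _ this]
        simp only [c1]
        congr 1
        funext i
        rcases S.idxFun i with b | d
        · cases b <;> simp [h0]
        · rcases d with _ | d
          · simp [h0]
          · simp only [Sum.elim_inr, Option.elim_some]
            rcases J d with _ | e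
            · simp
            · simp only [Option.elim_some]
              rcases s e with _ | f <;> simp
  · rintro m' v' ⟨s, hs, h⟩
    refine ⟨fun i => (S.idxFun i).elim (fun b => none)
      (fun d => d.elim none (fun d => (J d).elim none s)), ?_, ?_⟩
    · intro e
      obtain ⟨i1, h1⟩ := hs e
      obtain ⟨i, hi⟩ := S.proper (some (j i1))
      exact ⟨i, by simp [hi, hJ, h1]⟩
    · intro t ht
      rw [← h _ ht]
      simp only [c1]
      congr 1
      funext i
      rcases S.idxFun i with b | d
      · simp
      · rcases d with _ | d
        · simp
        · simp only [Sum.elim_inr, Option.elim_some]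
          rcases J d with _ | e <;> simp

lemma folkman (n : ℕ) : ∀ m1 m2 : ℕ, m1 + m2 = n → ∃ ι : Type, Finite ι ∧
    ∀ c : (ι → Bool) → Bool, FU m1 c true ∨ FU m2 c false := by
  induction n with
  | zero =>
    intro m1 m2 h
    obtain rfl : m1 = 0 := by omega
    exact ⟨Empty, inferInstance, fun c => Or.inl (FU_zero _ _)⟩
  | succ n ih =>
    intro m1 m2 h
    rcases m1 with _ | m1
    · exact ⟨Empty, inferInstance, fun c => Or.inl (FU_zero _ _)⟩
    rcases m2 with _ | m2
    · exact ⟨Empty, inferInstance, fun c => Or.inr (FU_zero _ _)⟩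
    obtain ⟨ι1, h1, H1⟩ := ih m1 (m2+1) (by omega)
    obtain ⟨ι2, h2, H2⟩ := ih (m1+1) m2 (by omega)
    obtain ⟨ι, hι, H⟩ := Subspace.exists_mono_in_high_dimension (α := Bool) (κ := Bool) (η := Option (ι1 ⊕ ι2))
    refine ⟨ι, inferInstance, fun c => ?_⟩
    obtain ⟨S, v, hS⟩ := H c
    cases v with
    | true =>
      obtain ⟨c1, hc, hc'⟩ := FU_step (Sum.inl : ι1 → ι1 ⊕ ι2) Sum.inl_injective m1 c true S hS
      rcases H1 c1 with h | h
      · exact Or.inl (hc h)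
      · exact Or.inr (hc' _ _ h)
    | false =>
      obtain ⟨c1, hc, hc'⟩ := FU_step (Sum.inr : ι2 → ι1 ⊕ ι2) Sum.inr_injective m2 c false S hS
      rcases H2 c1 with h | h
      · exact Or.inl (hc' _ _ h)
      · exact Or.inr (hc h)

lemma graham_rothschild (α : Type) [Finite α] [Nonempty α] (η : Type) [Finite η] :
    ∃ ι : Type, Finite ι ∧ ∀ C : (ι → Option α) → Bool, ∃ V : Subspace η α ι, ∃ v : Bool,
      ∀ x : η → Option α, (∃ e, x e = none) → C (sup V x) = v := by
  obtain ⟨m, ⟨E⟩⟩ := Finite.exists_equiv_fin η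
  obtain ⟨ι2, h2, H2⟩ := folkman (m+m) m m rfl
  obtain ⟨n, ⟨E2⟩⟩ := Finite.exists_equiv_fin ι2
  obtain ⟨ι, h1, H1⟩ := blockHJ α n Bool
  obtain ⟨a0⟩ := ‹Nonempty α›
  refine ⟨ι, h1, fun C => ?_⟩
  obtain ⟨V, hV⟩ := H1 C
  have key : ∃ v, FU m (fun u : ι2 → Bool => C (sup V (fun i => if u (E2.symm i) then none else some a0))) v := by
    rcases H2 (fun u => C (sup V (fun i => if u (E2.symm i) then none else some a0))) with h | h
    · exact ⟨_, h⟩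
    · exact ⟨_, h⟩
  obtain ⟨v, s, hs, h⟩ := key
  let W : Subspace η α (Fin n) :=
    { idxFun := fun i => (s (E2.symm i)).elim (Sum.inl a0) (fun e => Sum.inr (E.symm e))
      proper := by
        intro e
        obtain ⟨i, hi⟩ := hs (E e)
        exact ⟨E2 i, by simp [hi]⟩ }
  refine ⟨scomp V W, v, fun x ⟨e, hx⟩ => ?_⟩
  have e1 : sup (scomp V W) x = sup V (sup W x) := by
    funext i
    rw [Subspace.apply_def, Subspace.apply_def]
    rcases h : V.idxFun i with a | d
    · simp [sup, scomp, h]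
    · simp [sup, scomp, h, Subspace.apply_def]
  rw [e1, ← h (fun e => (x (E.symm e)).isNone) ⟨E e, by simp [hx]⟩]
  apply hV
  intro i
  rw [Subspace.apply_def]
  rcases h : s (E2.symm i) with _ | d
  · simp [sup, W, h]
  · simp [sup, W, h]

end DHJ

namespace DHJ
open Combinatorics

lemma exists_of_sum {κ : Type} [Fintype κ] (f : κ → ℝ) (d : ℝ) (hd : 0 < d) (h : d ≤ ∑ k, f k) :
    ∃ k, d / (Nat.card κ + 1) ≤ f k := by
  by_contra! hc
  have h1 : ∑ k, f k ≤ ∑ _k : κ, d / (Nat.card κ + 1) := Finset.sum_le_sum fun k _ => (hc k).le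
  rw [Finset.sum_const, Finset.card_univ, nsmul_eq_mul, Nat.card_eq_fintype_card] at h1
  have h2 : (0:ℝ) ≤ Fintype.card κ := by positivity
  have h3 : (Fintype.card κ : ℝ) * (d / (Fintype.card κ + 1)) < d := by
    rw [mul_div_assoc', div_lt_iff₀ (by positivity)]
    nlinarith
  linarith

/-- A family lemma: if every dense set contains a structure among finitely many, then structures are
frequently contained. -/
lemma exists_frequent {Y κ : Type} [Finite Y] [Nonempty Y] [Finite κ] (d : Y → ℝ)
    (hd1 : ∀ y, d y ≤ 1) (P : κ → Y → Prop) (δ : ℝ) (hδ : 0 < δ) (hav : δ ≤ av d)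
    (h : ∀ y, δ / 2 ≤ d y → ∃ k, P k y) : ∃ k, δ / 2 / (Nat.card κ + 1) ≤ av (fun y => ind (P k y)) := by
  have := Fintype.ofFinite κ
  apply exists_of_sum _ _ (by positivity)
  rw [← av_sum]
  have h1 : ∀ y, d y ≤ δ / 2 + ∑ k, ind (P k y) := by
    intro y
    have h0 : 0 ≤ ∑ k, ind (P k y) := Finset.sum_nonneg fun k _ => ind_nonneg _
    by_cases hy : δ / 2 ≤ d y
    · obtain ⟨k, hk⟩ := h y hy
      have : ind (P k y) ≤ ∑ k, ind (P k y) :=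
        Finset.single_le_sum (f := fun k => ind (P k y)) (fun k _ => ind_nonneg _) (Finset.mem_univ k)
      rw [ind_true hk] at this
      have := hd1 y
      linarith
    · push Not at hy
      linarith
  have h2 := av_mono h1
  rw [av_add, av_const] at h2
  linarith

lemma dens_swap {ι I R β : Type} [Finite ι] [Finite I] [Finite R] [Finite β] (e : ι ≃ I ⊕ R)
    (A : Set (ι → β)) :
    dens A = av (fun y : R → β => dens {x : I → β | (fun i => Sum.elim x y (e i)) ∈ A}) := by
  unfold dens
  rw [av_split e, av_comm]
  rfl

lemma mgood (β : Type) [Finite β] [Nonempty β] (h : ∀ δ > 0, Good β δ) (m : ℕ) :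
    ∀ δ > 0, MGood β m δ := by
  induction m with
  | zero =>
    intro δ hδ
    refine ⟨0, fun ι _ _ A hA => ?_⟩
    obtain ⟨x, hx⟩ := exists_le_of_av hA
    have hxA : x ∈ A := by
      by_contra hc
      rw [ind_false hc] at hx
      linarith
    refine ⟨⟨fun i => Sum.inl (x i), fun e => e.elim0⟩, fun z => ?_⟩
    exact hxA
  | succ m ih =>
    intro δ hδ
    obtain ⟨N1, H1⟩ := ih (δ / 2) (by positivity)
    obtain ⟨N2, H2⟩ := h (δ / 2 / (Nat.card (Subspace (Fin m) β (Fin N1)) + 1)) (by positivity)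
    refine ⟨N1 + N2, fun ι _ hι A hA => ?_⟩
    obtain ⟨r, hr, ⟨e⟩⟩ := exists_split ι N1 N2 hι
    rw [dens_swap e] at hA
    obtain ⟨S, hS⟩ := exists_frequent _ (fun y => dens_le_one _)
      (fun (S : Subspace (Fin m) β (Fin N1)) (y : Fin r → β) =>
        ∀ z, (fun i => Sum.elim (S z) y (e i)) ∈ A) δ hδ hA
      (fun y hy => H1 (Fin N1) (by simp) _ hy)
    obtain ⟨l, hl⟩ := H2 (Fin r) (by simpa using hr) {y | ∀ z, (fun i => Sum.elim (S z) y (e i)) ∈ A} hS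
    refine ⟨⟨fun i => Sum.elim (fun j => (S.idxFun j).map id Fin.succ)
      (fun j => (l.idxFun j).elim (Sum.inr 0) Sum.inl) (e i), ?_⟩, fun x => ?_⟩
    · intro d
      refine Fin.cases ?_ (fun d => ?_) d
      · obtain ⟨j, hj⟩ := l.proper
        exact ⟨e.symm (Sum.inr j), by simp [hj]⟩
      · obtain ⟨i, hi⟩ := S.proper d
        exact ⟨e.symm (Sum.inl i), by simp [hi]⟩
    · convert hl (x 0) (fun i => x i.succ) using 1
      funext i
      simp only [Subspace.apply_def]
      rcases e i with j | j
      · simp only [Sum.elim_inl, Subspace.apply_def]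
        cases h : S.idxFun j <;> simp
      · simp only [Sum.elim_inr, Line.apply_def]
        cases h : l.idxFun j <;> simp

/-! ### insensitive sets -/
variable {α ι η : Type}

def fil (b : α) (x : ι → Option α) : ι → Option α := fun i => some ((x i).getD b)

def Ins (b : α) (E : Set (ι → Option α)) : Prop := ∀ x, x ∈ E ↔ fil b x ∈ E

lemma fil_fil (b : α) (x : ι → Option α) : fil b (fil b x) = fil b x := rfl

lemma fil_sub (b : α) (V : Subspace η (Option α) ι) (x : η → Option α) :
    fil b (V (fil b x)) = fil b (V x) := by
  funext i
  simp only [fil, Subspace.apply_def]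
  cases V.idxFun i <;> simp [fil]

lemma Ins.sub {b : α} {E : Set (ι → Option α)} (h : Ins b E) (V : Subspace η (Option α) ι) :
    Ins b {x | V x ∈ E} := by
  intro x
  change V x ∈ E ↔ V (fil b x) ∈ E
  rw [h (V x), h (V (fil b x)), fil_sub]

open Classical in
noncomputable def fillJ (J : Finset ι) (z : J → α) : ι → Option α :=
  fun i => if h : i ∈ J then some (z ⟨i, h⟩) else none

lemma sum_le_sum_surj {X Y : Type} [Fintype X] [Fintype Y] (g : Y → X) (hg : Function.Surjective g)
    (f : X → ℝ) (hf : ∀ x, 0 ≤ f x) : ∑ x, f x ≤ ∑ y, f (g y) := by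
  classical
  obtain ⟨s, hs⟩ := hg.hasRightInverse
  calc ∑ x, f x = ∑ x, f (g (s x)) := by simp only [hs _]
    _ = ∑ y ∈ Finset.univ.map ⟨s, hs.injective⟩, f (g y) := by simp
    _ ≤ _ := Finset.sum_le_sum_of_subset_of_nonneg (Finset.subset_univ _) fun y _ _ => hf _

lemma ins_sub (α : Type) [Finite α] [Nonempty α] (m : ℕ) (hM : ∀ δ > 0, MGood α m δ) (ε : ℝ) (hε : 0 < ε) :
    ∃ M : ℕ, ∀ (ι : Type) [Finite ι], M ≤ Nat.card ι → ∀ (E : Set (ι → Option α)) (b : α), Ins b E →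
      ε ≤ dens E → ∃ S : Subspace (Fin m) (Option α) ι, ∀ x, S x ∈ E := by
  classical
  have := Fintype.ofFinite α
  obtain ⟨n0, H0⟩ := hM (ε / 2) (by positivity)
  set k : ℝ := (Fintype.card α : ℝ) with hk
  have hk0 : 0 < k := by rw [hk]; exact_mod_cast Fintype.card_pos
  have hq : (k / 2 + 1) / (k + 1) < 1 := by rw [div_lt_one (by positivity)]; linarith
  have hq0 : 0 < (k / 2 + 1) / (k + 1) := by positivity
  obtain ⟨M, hMM⟩ := exists_pow_lt_of_lt_one (show 0 < ε / 2 / 2 ^ n0 by positivity) hq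
  refine ⟨M, fun ι _ hι E b hE hd => ?_⟩
  have := Fintype.ofFinite ι
  rw [Nat.card_eq_fintype_card] at hι
  have main : ∃ J : Finset ι, n0 ≤ J.card ∧ ε / 2 * k ^ J.card ≤ ∑ z : J → α, ind (fillJ J z ∈ E) := by
    by_contra! hc
    have hb : ∀ J : Finset ι, ∑ z : J → α, ind (fillJ J z ∈ E) ≤
        ε / 2 * k ^ J.card + 2 ^ n0 * (k / 2) ^ J.card := by
      intro J
      by_cases hJ : n0 ≤ J.card
      · have := hc J hJ
        have : 0 ≤ 2 ^ n0 * (k / 2) ^ J.card := by positivity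
        linarith
      · push Not at hJ
        have h1 : ∑ z : J → α, ind (fillJ J z ∈ E) ≤ ∑ z : J → α, (1:ℝ) :=
          Finset.sum_le_sum fun z _ => ind_le_one _
        have h2 : ∑ z : J → α, (1:ℝ) = k ^ J.card := by simp [hk]
        have h3 : k ^ J.card ≤ 2 ^ n0 * (k / 2) ^ J.card := by
          rw [div_pow, mul_div_assoc', le_div_iff₀ (by positivity), mul_comm]
          gcongr
          norm_num
        have : 0 ≤ ε / 2 * k ^ J.card := by positivity
        linarith
    have hsurj : Function.Surjective (fun p : Σ J : Finset ι, (J → α) => fillJ p.1 p.2) := by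
      intro x
      refine ⟨⟨Finset.univ.filter (fun i => (x i).isSome), fun i => (x i).get (Finset.mem_filter.1 i.2).2⟩, ?_⟩
      funext i
      simp only [fillJ]
      split_ifs with h
      · simp
      · simp only [Finset.mem_filter, Finset.mem_univ, true_and] at h
        exact (by simpa using h : x i = none).symm
    have h1 := sum_le_sum_surj _ hsurj (fun x => ind (x ∈ E)) (fun x => ind_nonneg _)
    rw [Fintype.sum_sigma] at h1
    have h2 : ∑ J : Finset ι, ∑ z : J → α, ind (fillJ J z ∈ E) ≤
        ∑ J : Finset ι, (ε / 2 * k ^ J.card + 2 ^ n0 * (k / 2) ^ J.card) :=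
      Finset.sum_le_sum fun J _ => hb J
    have h3 : ∀ c : ℝ, ∑ J : Finset ι, c ^ J.card = (c + 1) ^ Fintype.card ι := by
      intro c
      have := Fintype.sum_pow_mul_eq_add_pow ι c 1
      simpa using this
    rw [Finset.sum_add_distrib, ← Finset.mul_sum, ← Finset.mul_sum, h3, h3] at h2
    have h4 : ε * (k + 1) ^ Fintype.card ι ≤ ∑ x, ind (x ∈ E) := by
      unfold dens at hd
      rw [av_eq, le_div_iff₀ (by positivity)] at hd
      have hcc : (Fintype.card (ι → Option α) : ℝ) = (k + 1) ^ Fintype.card ι := by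
        rw [hk, Fintype.card_fun, Fintype.card_option]; push_cast; simp
      rw [hcc] at hd
      exact hd
    have h5 : ((k / 2 + 1) / (k + 1)) ^ Fintype.card ι < ε / 2 / 2 ^ n0 :=
      (pow_le_pow_of_le_one hq0.le hq.le hι).trans_lt hMM
    rw [div_pow, div_lt_div_iff₀ (by positivity) (by positivity)] at h5
    linarith
  obtain ⟨J, hJ, hsum⟩ := main
  obtain ⟨S, hS⟩ := H0 J (by simpa using hJ) {z | fillJ J z ∈ E} (by
    unfold dens
    rw [av_eq, le_div_iff₀ (by positivity)]
    have hcc : (Fintype.card (J → α) : ℝ) = k ^ J.card := by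
      rw [hk, Fintype.card_fun, Fintype.card_coe]; push_cast; simp
    rw [hcc]
    exact hsum)
  let W : Subspace (Fin m) (Option α) ι :=
    { idxFun := fun i => if h : i ∈ J then (S.idxFun ⟨i, h⟩).map some id else Sum.inl none
      proper := by
        intro d
        obtain ⟨i, hi⟩ := S.proper d
        exact ⟨i, by simp [hi]⟩ }
  refine ⟨W, fun x => ?_⟩
  have h1 : W x ∈ E ↔ W (fil b x) ∈ E := hE.sub W x
  rw [h1]
  have h2 : W (fil b x) = fillJ J (S (fun e => (x e).getD b)) := by
    funext i
    rw [Subspace.apply_def]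
    simp only [W, fillJ]
    split_ifs with h
    · rw [Subspace.apply_def]
      cases S.idxFun ⟨i, h⟩ <;> simp [fil]
    · simp
  rw [h2]
  exact hS _

lemma av_range {X Z : Type} [Finite X] [Finite Z] [Nonempty Z] (V : Z → X) (hV : Function.Injective V) (f : X → ℝ) :
    av (fun x => f x * ind (x ∈ Set.range V)) = (Nat.card Z / Nat.card X : ℝ) * av (fun z => f (V z)) := by
  classical
  have := Fintype.ofFinite X
  have := Fintype.ofFinite Z
  rw [av_eq, av_eq, Nat.card_eq_fintype_card, Nat.card_eq_fintype_card]
  have h : ∑ x, f x * ind (x ∈ Set.range V) = ∑ z, f (V z) := by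
    rw [← Finset.sum_image (f := f) (s := Finset.univ) (g := V) (fun a _ b _ h => hV h)]
    rw [← Finset.sum_subset (Finset.subset_univ (Finset.univ.image V))]
    · apply Finset.sum_congr rfl
      intro x hx
      rw [ind_true (by simpa using hx), mul_one]
    · intro x _ hx
      rw [ind_false (by simpa using hx), mul_zero]
  rw [h]
  have : (Fintype.card Z : ℝ) ≠ 0 := by exact_mod_cast Fintype.card_ne_zero
  field_simp

lemma fill_aux (α : Type) [Finite α] [Nonempty α] (m M : ℕ) (b : α) (ε : ℝ) (hε : 0 < ε)
    (H : ∀ E : Set (Fin M → Option α), Ins b E → ε ≤ dens E →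
      ∃ S : Subspace (Fin m) (Option α) (Fin M), ∀ x, S x ∈ E)
    (c : ℝ) (hc : c = 1 / Nat.card (Fin M → Option α)) (hc1 : c ≤ 1) (T : ℕ) :
    ∀ (ι : Type) [Finite ι], T * M ≤ Nat.card ι → ∀ E : Set (ι → Option α), Ins b E →
    ∀ g : (ι → Option α) → ℝ, (∀ x, g x ≤ 1) →
    (∀ W : Subspace (Fin m) (Option α) ι, av (fun x => g (W x)) ≤ 0) →
    av (fun x => g x * ind (x ∈ E)) ≤ ε + (1 - c) ^ T * (dens E - ε) := by
  induction T with
  | zero =>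
    intro ι _ _ E _ g hg _
    have : av (fun x => g x * ind (x ∈ E)) ≤ dens E := av_mono fun x => by
      have := ind_nonneg (x ∈ E)
      have := hg x
      nlinarith
    simpa using this
  | succ T ih =>
    intro ι _ hι E hE g hg hW
    obtain ⟨r, hr, ⟨e⟩⟩ := exists_split ι M (T * M) (by linarith)
    let cat : (Fin M → Option α) → (Fin r → Option α) → (ι → Option α) :=
      fun x y => fun i => Sum.elim x y (e i)
    have hcat : ∀ x y, fil b (cat x y) = cat (fil b x) (fil b y) := by
      intro x y
      funext i
      simp only [cat, fil]
      rcases e i with j | j <;> simp [fil]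
    let Sec : (Fin r → Option α) → Set (Fin M → Option α) := fun y => {x | cat x y ∈ E}
    have hSec1 : ∀ y, Ins b (Sec y) := by
      intro y x
      change cat x y ∈ E ↔ cat (fil b x) y ∈ E
      rw [hE (cat x y), hE (cat (fil b x) y), hcat, hcat, fil_fil]
    have hSec2 : ∀ y, Sec (fil b y) = Sec y := by
      intro y
      ext x
      change cat x (fil b y) ∈ E ↔ cat x y ∈ E
      rw [hE (cat x y), hE (cat x (fil b y)), hcat, hcat, fil_fil]
    choose σ hσ using H
    let rem : Set (Fin M → Option α) → (Fin M → Option α) → Prop :=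
      fun Z x => ∃ (h1 : Ins b Z) (h2 : ε ≤ dens Z), x ∈ Set.range (fun z => σ Z h1 h2 z)
    have hrem : ∀ Z x, rem Z x → x ∈ Z := by
      rintro Z x ⟨h1, h2, z, rfl⟩
      exact hσ Z h1 h2 z
    let E' : (Fin M → Option α) → Set (Fin r → Option α) := fun x => {y | x ∈ Sec y ∧ ¬ rem (Sec y) x}
    have hE' : ∀ x, Ins b (E' x) := by
      intro x y
      change (x ∈ Sec y ∧ ¬ rem (Sec y) x) ↔ (x ∈ Sec (fil b y) ∧ ¬ rem (Sec (fil b y)) x)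
      rw [hSec2]
    have hind : ∀ x y, ind (x ∈ Sec y) = ind (y ∈ E' x) + ind (rem (Sec y) x) := by
      intro x y
      by_cases h : rem (Sec y) x
      · have h2 : ¬ (y ∈ E' x) := fun h3 => h3.2 h
        rw [ind_true h, ind_true (hrem _ _ h), ind_false h2, zero_add]
      · rw [ind_false h, add_zero]
        by_cases h2 : x ∈ Sec y
        · rw [ind_true h2, ind_true (show y ∈ E' x from ⟨h2, h⟩)]
        · rw [ind_false h2, ind_false (fun h3 : y ∈ E' x => h2 h3.1)]
    have hremg : ∀ y, av (fun x => g (cat x y) * ind (rem (Sec y) x)) ≤ 0 := by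
      intro y
      by_cases h : ε ≤ dens (Sec y)
      · have : ∀ x, rem (Sec y) x ↔ x ∈ Set.range (fun z => σ (Sec y) (hSec1 y) h z) :=
          fun x => ⟨fun ⟨_, _, h⟩ => h, fun h' => ⟨hSec1 y, h, h'⟩⟩
        simp only [this]
        rw [av_range _ (subspace_injective _) (fun x => g (cat x y))]
        apply mul_nonpos_of_nonneg_of_nonpos (by positivity)
        have := hW (sext e (σ (Sec y) (hSec1 y) h) y)
        simpa only [sext_apply] using this
      · have : ∀ x, ¬ rem (Sec y) x := fun x ⟨_, h2, _⟩ => h h2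
        simp only [ind_false (this _), mul_zero]
        rw [av_const]
    have hremc : ∀ y, c * (dens (Sec y) - ε) ≤ av (fun x => ind (rem (Sec y) x)) := by
      intro y
      have hc0 : 0 ≤ c := by rw [hc]; positivity
      by_cases h : ε ≤ dens (Sec y)
      · have h1 : rem (Sec y) (σ (Sec y) (hSec1 y) h (fun _ => none)) := ⟨hSec1 y, h, _, rfl⟩
        have h2 := single_le_av (f := fun x => ind (rem (Sec y) x)) (fun x => ind_nonneg _)
          (σ (Sec y) (hSec1 y) h (fun _ => none))
        simp only [ind_true h1] at h2
        rw [← hc] at h2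
        have := dens_le_one (Sec y)
        nlinarith
      · push Not at h
        have : 0 ≤ av (fun x => ind (rem (Sec y) x)) := av_nonneg fun x => ind_nonneg _
        nlinarith
    have hdE : dens E = av (fun y => dens (Sec y)) := dens_swap e E
    have hdE' : av (fun x => dens (E' x)) ≤ dens E - c * (dens E - ε) := by
      unfold dens at hdE ⊢
      rw [av_comm, hdE, ← av_const (X := Fin r → Option α) ε, ← av_sub, ← av_mul, ← av_sub]
      apply av_mono
      intro y
      have h1 := hremc y
      unfold dens at h1
      have h2 : av (fun x => ind (x ∈ Sec y)) = av (fun x => ind (y ∈ E' x)) + av (fun x => ind (rem (Sec y) x)) := by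
        rw [← av_add]
        simp only [hind]
      linarith
    calc av (fun x => g x * ind (x ∈ E))
        = av (fun y => av (fun x => g (cat x y) * ind (x ∈ Sec y))) := by
          rw [av_split e, av_comm]; rfl
      _ ≤ av (fun y => av (fun x => g (cat x y) * ind (y ∈ E' x))) := by
          apply av_mono
          intro y
          have := hremg y
          simp only [hind, mul_add]
          rw [av_add]
          linarith
      _ = av (fun x => av (fun y => g (cat x y) * ind (y ∈ E' x))) := by rw [av_comm]
      _ ≤ av (fun x => ε + (1 - c) ^ T * (dens (E' x) - ε)) := by
          apply av_mono
          intro x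
          apply ih (Fin r) (by simpa using hr) (E' x) (hE' x) (fun y => g (cat x y)) (fun y => hg _)
          intro W
          have := hW (sext2 e x W)
          simpa only [sext2_apply] using this
      _ = ε + (1 - c) ^ T * (av (fun x => dens (E' x)) - ε) := by
          rw [av_add, av_mul, av_sub, av_const]
      _ ≤ ε + (1 - c) ^ T * ((1 - c) * (dens E - ε)) := by
          have : 0 ≤ (1 - c) ^ T := pow_nonneg (by linarith) _
          gcongr
          linarith
      _ = _ := by ring

lemma fill1 (α : Type) [Finite α] [Nonempty α] (m : ℕ) (hM : ∀ δ > 0, MGood α m δ) (b : α) (ε : ℝ)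
    (hε : 0 < ε) :
    ∃ n : ℕ, ∀ (ι : Type) [Finite ι], n ≤ Nat.card ι → ∀ E : Set (ι → Option α), Ins b E →
    ∀ g : (ι → Option α) → ℝ, (∀ x, g x ≤ 1) →
    (∀ W : Subspace (Fin m) (Option α) ι, av (fun x => g (W x)) ≤ 0) →
    av (fun x => g x * ind (x ∈ E)) ≤ ε := by
  obtain ⟨M, H⟩ := ins_sub α m hM (ε / 2) (by positivity)
  set K : ℝ := ((Nat.card (Fin M → Option α) : ℕ) : ℝ) with hK
  have hK1 : 1 ≤ K := by
    rw [hK]; exact_mod_cast Nat.one_le_iff_ne_zero.2 Nat.card_pos.ne'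
  have hc : 1 / K ≤ 1 := by rw [div_le_one (by positivity)]; exact hK1
  have hc0 : 0 < 1 / K := by positivity
  obtain ⟨T, hT⟩ := exists_pow_lt_of_lt_one (show 0 < ε / 2 by positivity) (show 1 - 1 / K < 1 by linarith)
  refine ⟨T * M, fun ι _ hι E hE g hg hW => ?_⟩
  have := fill_aux α m M b (ε / 2) (by positivity) (fun E hE hd => H (Fin M) (by simp) E b hE hd) (1 / K) rfl hc T
    ι hι E hE g hg hW
  have h1 := dens_le_one E
  have h0 : 0 ≤ (1 - 1 / K) ^ T := pow_nonneg (by linarith) _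
  nlinarith

lemma fill (α : Type) [Finite α] [Nonempty α] (hM : ∀ m, ∀ δ > 0, MGood α m δ) (T : Finset α) :
    ∀ (m : ℕ) (ε : ℝ), 0 < ε →
    ∃ n : ℕ, ∀ (ι : Type) [Finite ι], n ≤ Nat.card ι → ∀ F : α → Set (ι → Option α), (∀ b, Ins b (F b)) →
    ∀ g : (ι → Option α) → ℝ, (∀ x, g x ≤ 1) →
    (∀ W : Subspace (Fin m) (Option α) ι, av (fun x => g (W x)) ≤ 0) →
    av (fun x => g x * ind (∀ b ∈ T, x ∈ F b)) ≤ ε := by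
  classical
  induction T using Finset.induction_on with
  | empty =>
    intro m ε hε
    refine ⟨m, fun ι _ hι F hF g hg hW => ?_⟩
    obtain ⟨r, hr, ⟨e⟩⟩ := exists_split ι m 0 (by omega)
    have h1 : ∀ x : ι → Option α, ind (∀ b ∈ (∅ : Finset α), x ∈ F b) = 1 := fun x => ind_true (by simp)
    simp only [h1, mul_one]
    rw [av_split e, av_comm]
    refine le_trans (av_le (c := 0) fun y => ?_) hε.le
    have := hW (sext e sid y)
    simpa only [sext_apply, sid_apply] using this
  | insert b T hb ih =>
    intro m ε hε
    obtain ⟨n1, H1⟩ := ih m (ε / 2) (by positivity)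
    obtain ⟨n2, H2⟩ := fill1 α n1 (hM n1) b (ε / 2) (by positivity)
    refine ⟨n2, fun ι _ hι F hF g hg hW => ?_⟩
    have h := H2 ι hι (F b) (hF b) (fun x => g x * ind (∀ b ∈ T, x ∈ F b) - ε / 2) ?_ ?_
    · have h3 : ∀ x, g x * ind (∀ c ∈ insert b T, x ∈ F c) ≤
          (g x * ind (∀ b ∈ T, x ∈ F b) - ε / 2) * ind (x ∈ F b) + ε / 2 := by
        intro x
        simp only [Finset.forall_mem_insert, ind_and]
        have := ind_le_one (x ∈ F b)
        nlinarith
      have h4 := av_mono h3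
      rw [av_add, av_const] at h4
      linarith
    · intro x
      have h1 := hg x
      have h2 := ind_nonneg (∀ b ∈ T, x ∈ F b)
      have h3 := ind_le_one (∀ b ∈ T, x ∈ F b)
      nlinarith
    · intro W
      have := H1 (Fin n1) (by simp) (fun c => {x | W x ∈ F c}) (fun c => (hF c).sub W) (fun x => g (W x))
        (fun x => hg _) (fun W' => by
          have := hW (scomp W W')
          simpa only [scomp_apply] using this)
      rw [av_sub, av_const]
      simp only [Set.mem_setOf_eq] at this
      linarith

end DHJ

namespace DHJ
open Combinatorics

lemma nonone (α : Type) [Finite α] [Nonempty α] (τ : ℝ) (hτ : 0 < τ) :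
    ∃ n : ℕ, ∀ (η : Type) [Finite η], n ≤ Nat.card η →
      dens {x : η → Option α | ∀ e, x e ≠ none} ≤ τ := by
  classical
  have := Fintype.ofFinite α
  set k : ℝ := (Fintype.card α : ℝ) with hk
  have hk0 : 0 < k := by rw [hk]; exact_mod_cast Fintype.card_pos
  have hq : k / (k + 1) < 1 := by rw [div_lt_one (by positivity)]; linarith
  have hq0 : 0 < k / (k + 1) := by positivity
  obtain ⟨n, hn⟩ := exists_pow_lt_of_lt_one hτ hq
  refine ⟨n, fun η _ hη => ?_⟩
  have := Fintype.ofFinite η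
  rw [Nat.card_eq_fintype_card] at hη
  have h := av_range (fun (z : η → α) => fun e => some (z e))
    (fun a b hab => by
      funext e
      have := congrFun hab e
      simpa using this) (fun _ => (1:ℝ))
  rw [av_const, mul_one, Nat.card_eq_fintype_card, Nat.card_eq_fintype_card, Fintype.card_fun,
    Fintype.card_fun, Fintype.card_option] at h
  have h2 : dens {x : η → Option α | ∀ e, x e ≠ none} ≤ (k / (k + 1)) ^ Fintype.card η := by
    unfold dens
    rw [div_pow]
    push_cast at h
    rw [← hk] at h
    rw [← h]
    apply av_mono
    intro x
    rw [one_mul]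
    apply ind_mono
    intro hx
    choose z hz using fun e => Option.ne_none_iff_exists.1 (hx e)
    exact ⟨z, funext hz⟩
  exact h2.trans ((pow_le_pow_of_le_one hq0.le hq.le hη).trans hn.le)

lemma line_of_BD {α η : Type} (B : Set (η → Option α)) (x : η → Option α) (hx : x ∈ B)
    (hD : ∀ a, fil a x ∈ B) (hn : ∃ e, x e = none) : HasLine B := by
  obtain ⟨e, he⟩ := hn
  refine ⟨⟨fun i => (x i).map some, e, by simp [he]⟩, fun b => ?_⟩
  rcases b with _ | a
  · convert hx using 1
    funext i
    rw [Line.apply_def]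
    change ((x i).map some).getD none = x i
    cases x i <;> rfl
  · convert hD a using 1
    funext i
    rw [Line.apply_def]
    change ((x i).map some).getD (some a) = some ((x i).getD a)
    cases x i <;> rfl

lemma endgame (α : Type) [Finite α] [Nonempty α] (hα : ∀ δ > 0, Good α δ) (δ σ : ℝ) (hδ : 0 < δ) (hσ : 0 < σ)
    (h : ∀ ε > 0, Good (Option α) (δ + ε)) :
    ∃ n : ℕ, ∀ (η : Type) [Finite η], n ≤ Nat.card η → ∀ B : Set (η → Option α), ¬ HasLine B →
      δ - 2 * (δ * σ / 8) ≤ dens B → σ ≤ dens {x | ∀ a, fil a x ∈ B} → False := by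
  classical
  have := Fintype.ofFinite α
  set ρ := δ * σ / 8 with hρ
  have hρ0 : 0 < ρ := by positivity
  obtain ⟨m, Hm⟩ := h ρ hρ0
  obtain ⟨n1, Hn1⟩ := nonone α ρ hρ0
  obtain ⟨n2, Hn2⟩ := fill α (mgood α hα) Finset.univ m (ρ / 2 ^ Fintype.card α) (by positivity)
  refine ⟨n1 + n2, fun η _ hη B hB hd hD => ?_⟩
  set D : Set (η → Option α) := {x | ∀ a, fil a x ∈ B} with hDdef
  let g : (η → Option α) → ℝ := fun x => ind (x ∈ B) - (δ + ρ)
  have hg1 : ∀ x, g x ≤ 1 := fun x => by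
    have := ind_le_one (x ∈ B)
    simp only [g]; linarith
  have hgW : ∀ W : Subspace (Fin m) (Option α) η, av (fun x => g (W x)) ≤ 0 := by
    intro W
    by_contra! hc
    simp only [g] at hc
    rw [av_sub, av_const] at hc
    have hc2 : δ + ρ ≤ av (fun x => ind (W x ∈ B)) := by linarith
    exact hB (HasLine.of_subspace W (Hm (Fin m) (by simp) {x | W x ∈ B} hc2))
  have hP : ∀ P : Finset α, av (fun x => g x * ind (∀ b ∈ (Finset.univ : Finset α), x ∈ {x | fil b x ∈ B ↔ b ∈ P}))
      ≤ ρ / 2 ^ Fintype.card α := fun P =>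
    Hn2 η (by omega) (fun b => {x | fil b x ∈ B ↔ b ∈ P}) (fun b x => by
      change _ ↔ (fil b (fil b x) ∈ B ↔ b ∈ P)
      rw [fil_fil]; rfl) g hg1 hgW
  have hsum : av (fun x => g x * ind (x ∉ D)) ≤ ρ := by
    have e1 : ∀ x, g x * ind (x ∉ D) = ∑ P ∈ Finset.univ.filter (fun P : Finset α => P ≠ Finset.univ),
        g x * ind (∀ b ∈ (Finset.univ : Finset α), x ∈ {x | fil b x ∈ B ↔ b ∈ P}) := by
      intro x
      rw [← Finset.mul_sum]
      congr 1
      let P0 : Finset α := Finset.univ.filter (fun b => fil b x ∈ B)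
      have hP0 : ∀ P : Finset α, (∀ b ∈ (Finset.univ : Finset α), x ∈ {x | fil b x ∈ B ↔ b ∈ P}) ↔ P = P0 := by
        intro P
        constructor
        · intro hh
          ext b
          have : fil b x ∈ B ↔ b ∈ P := hh b (Finset.mem_univ b)
          simp [P0, this]
        · rintro rfl b _
          change fil b x ∈ B ↔ b ∈ P0
          simp [P0]
      have hDP : x ∈ D ↔ P0 = Finset.univ := by
        rw [Finset.eq_univ_iff_forall]
        simp [P0, D]
      simp only [hP0]
      by_cases hx : x ∈ D
      · rw [ind_false (by simpa using hx), Finset.sum_eq_zero]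
        intro P hP
        apply ind_false
        rintro rfl
        exact (Finset.mem_filter.1 hP).2 (hDP.1 hx)
      · rw [ind_true hx, Finset.sum_eq_single P0]
        · rw [ind_true rfl]
        · intro P _ hP
          exact ind_false hP
        · intro hh
          exfalso
          apply hh
          simp only [Finset.mem_filter, Finset.mem_univ, true_and]
          exact fun h => hx (hDP.2 h)
    simp only [e1]
    rw [av_sum]
    calc _ ≤ ∑ P ∈ Finset.univ.filter (fun P : Finset α => P ≠ Finset.univ), ρ / 2 ^ Fintype.card α :=
          Finset.sum_le_sum fun P _ => hP P
      _ ≤ ∑ P : Finset α, ρ / 2 ^ Fintype.card α :=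
          Finset.sum_le_sum_of_subset_of_nonneg (Finset.filter_subset _ _) fun _ _ _ => by positivity
      _ = ρ := by
          rw [Finset.sum_const, Finset.card_univ, Fintype.card_finset, nsmul_eq_mul]
          push_cast
          field_simp
  have hBD : av (fun x => ind (x ∈ B) * ind (x ∈ D)) ≤ ρ := by
    refine le_trans (av_mono fun x => ?_) (Hn1 η (by omega))
    rw [← ind_and]
    apply ind_mono
    rintro ⟨hx, hxD⟩ e he
    exact hB (line_of_BD B x hx hxD ⟨e, he⟩)
  have hfin : av (fun x => g x * ind (x ∉ D)) =
      dens B - (δ + ρ) - (av (fun x => ind (x ∈ B) * ind (x ∈ D)) - (δ + ρ) * dens D) := by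
    have : ∀ x, g x * ind (x ∉ D) = (ind (x ∈ B) - (δ + ρ)) -
        (ind (x ∈ B) * ind (x ∈ D) - (δ + ρ) * ind (x ∈ D)) := by
      intro x
      rw [ind_not]; simp only [g]; ring
    simp only [this]
    rw [av_sub, av_sub, av_sub, av_const, av_mul]
    rfl
  have h8 : δ * σ = 8 * ρ := by rw [hρ]; ring
  have h9 : 8 * ρ ≤ (δ + ρ) * dens D := by
    rw [← h8]
    apply mul_le_mul (by linarith) hD hσ.le (by positivity)
  linarith

lemma family (α : Type) [Finite α] [Nonempty α] (hα : ∀ δ > 0, Good α δ) (δ : ℝ) (hδ : 0 < δ) :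
    ∃ (n0 : ℕ) (θ : ℝ), 0 < θ ∧ θ ≤ 1 ∧ ∀ (Y : Type) [Finite Y] [Nonempty Y] (A : (Fin n0 → α) → Set Y),
      (∀ t, δ ≤ av (fun y => ind (y ∈ A t))) →
      ∃ l : Line α (Fin n0), θ ≤ av (fun y => ind (∀ a, y ∈ A (l a))) := by
  obtain ⟨n0, H⟩ := hα (δ / 2) (by positivity)
  refine ⟨n0, min 1 (δ / 2 / (Nat.card (Line α (Fin n0)) + 1)), by positivity, min_le_left _ _, ?_⟩
  intro Y _ _ A hA
  obtain ⟨l, hl⟩ := exists_frequent (fun y => dens {t | y ∈ A t}) (fun y => dens_le_one _)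
    (fun (l : Line α (Fin n0)) y => ∀ a, y ∈ A (l a)) δ hδ (by
      unfold dens
      rw [av_comm]
      exact le_av hA) (fun y hy => H (Fin n0) (by simp) _ hy)
  exact ⟨l, (min_le_right _ _).trans hl⟩

lemma choose_y {Y : Type} [Finite Y] [Nonempty Y] (b d : Y → ℝ) (δ θ ρ : ℝ) (hρ : 0 < ρ) (hθ : 0 < θ) (hθ1 : θ ≤ 1)
    (hb : δ - ρ * θ / 8 ≤ av b) (hd : θ / 2 ≤ av d) (hb1 : ∀ y, b y ≤ δ + ρ * θ / 8) (hd1 : ∀ y, d y ≤ 1) :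
    ∃ y, θ / 4 ≤ d y ∧ δ - 2 * ρ ≤ b y := by
  have h : δ - ρ * θ / 8 + ρ * (θ / 2) ≤ av (fun y => b y + ρ * d y) := by
    rw [av_add, av_mul]
    have := mul_le_mul_of_nonneg_left hd hρ.le
    linarith
  obtain ⟨y, hy⟩ := exists_le_of_av h
  have h1 := hb1 y
  have h2 := hd1 y
  refine ⟨y, ?_, ?_⟩
  · have : ρ * (θ / 4) ≤ ρ * d y := by linarith
    exact le_of_mul_le_mul_left this hρ
  · nlinarith

lemma fil_sup {α ι η : Type} (b : α) (V : Subspace η α ι) (x : η → Option α) :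
    fil b (sup V x) = sup V (fil b x) := by
  funext i
  simp only [fil, Subspace.apply_def]
  cases h : V.idxFun i <;> simp [sup, h, fil]

lemma core (α : Type) [Finite α] [Nonempty α] (hα : ∀ δ > 0, Good α δ) (δ : ℝ) (hδ : 0 < δ)
    (h : ∀ ε > 0, Good (Option α) (δ + ε)) : ∃ ε0 > 0, ε0 < δ ∧ Good (Option α) (δ - ε0) := by
  classical
  obtain ⟨n0, θ, hθ, hθ1, Hfam⟩ := family α hα (δ / 2) (by positivity)
  set ρ : ℝ := δ * (θ / 4) / 8 with hρ
  have hρ0 : 0 < ρ := by positivity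
  obtain ⟨n2, Hend⟩ := endgame α hα δ (θ / 4) hδ (by positivity) h
  rw [← hρ] at Hend
  set γ : ℝ := ρ * θ / 8 with hγ
  have hγ0 : 0 < γ := by positivity
  have hγδ : γ ≤ δ / 2 := by
    have : ρ ≤ δ := by rw [hρ]; nlinarith
    rw [hγ]; nlinarith
  obtain ⟨N1, HN1⟩ := h γ hγ0
  obtain ⟨n3, Hn3⟩ := nonone α (1/2) (by norm_num)
  let η : Type := Fin n0 ⊕ Fin (n2 + N1 + n3)
  have hη : Nat.card η = n0 + (n2 + N1 + n3) := by simp [η]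
  obtain ⟨I, hI, HGR⟩ := graham_rothschild α η
  set K : ℝ := ((Nat.card (I → Option α) : ℕ) : ℝ) with hK
  have hK1 : 1 ≤ K := by
    rw [hK]; exact_mod_cast Nat.one_le_iff_ne_zero.2 Nat.card_pos.ne'
  obtain ⟨ε0, hε0, hε1, hε2⟩ : ∃ ε0 > 0, ε0 < δ ∧ 2 * ε0 * K ≤ γ := by
    refine ⟨min (δ / 2) (γ / (2 * K)), by positivity, (min_le_left _ _).trans_lt (by linarith), ?_⟩
    have := min_le_right (δ / 2) (γ / (2 * K))
    rw [le_div_iff₀ (by positivity)] at this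
    linarith
  obtain ⟨N', HN'⟩ := h ε0 hε0
  refine ⟨ε0, hε0, hε1, Nat.card I + N', fun ι _ hι A hA => ?_⟩
  by_contra hno
  obtain ⟨r, hr, ⟨e0⟩⟩ := exists_split ι _ _ hι
  let e : ι ≃ I ⊕ Fin r := e0.trans (Equiv.sumCongr (Finite.equivFin I).symm (Equiv.refl _))
  clear_value e
  let cat : (I → Option α) → (Fin r → Option α) → (ι → Option α) :=
    fun x y => fun i => Sum.elim x y (e i)
  have h1 : ∀ x, av (fun y => ind (cat x y ∈ A)) < δ + ε0 := by
    intro x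
    by_contra! hc
    obtain hl := HN' (Fin r) (by simpa using hr) {y | cat x y ∈ A} hc
    refine hno (HasLine.of_subspace (sext2 e x sid) ?_)
    convert hl using 4
    rw [sext2_apply, sid_apply]
  have h2 : ∀ x, δ - γ ≤ av (fun y => ind (cat x y ∈ A)) := by
    intro x
    have := single_le_av (f := fun x => (δ + ε0) - av (fun y => ind (cat x y ∈ A)))
      (fun x => by have := h1 x; linarith) x
    rw [av_sub, av_const, ← hK, div_le_iff₀ (by positivity)] at this
    unfold dens at hA
    rw [av_split e] at hA
    have h5 : ((δ + ε0) - av (fun x => av (fun y => ind (cat x y ∈ A)))) * K ≤ 2 * ε0 * K := by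
      gcongr
      change δ - ε0 ≤ av (fun x => av (fun y => ind (cat x y ∈ A))) at hA
      linarith
    linarith
  obtain ⟨V, v, hV⟩ := HGR (fun u => decide (θ ≤ av (fun y => ind (∀ a, cat (fil a u) y ∈ A))))
  have hv : v = true := by
    have a0 : α := Classical.arbitrary α
    obtain ⟨l, hl⟩ := Hfam (Fin r → Option α)
      (fun t => {y | cat (sup V (Sum.elim (fun j => some (t j)) (fun _ => some a0))) y ∈ A})
      (fun t => by
        refine le_trans ?_ (h2 (sup V (Sum.elim (fun j => some (t j)) (fun _ => some a0))))
        linarith)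
    obtain ⟨j, hj⟩ := l.proper
    rw [← hV (Sum.elim l.idxFun (fun _ => some a0)) ⟨Sum.inl j, by simpa using hj⟩]
    rw [decide_eq_true_iff]
    convert hl using 5 with y a
    rw [fil_sup]
    have : fil a (Sum.elim l.idxFun (fun _ => some a0) : η → Option α) =
        Sum.elim (fun j => some (l a j)) (fun _ => some a0) := by
      funext i
      rcases i with i | i
      · simp [fil, Line.apply_def]
      · simp [fil]
    rw [this]
    rfl
  subst hv
  let B : (Fin r → Option α) → Set (η → Option α) := fun y => {x | cat (sup V x) y ∈ A}
  have hBno : ∀ y, ¬ HasLine (B y) := by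
    intro y hl
    refine hno (HasLine.of_subspace (sext e (sup V) y) ?_)
    convert hl using 4
    rw [sext_apply]
  have hB1 : ∀ y, dens (B y) ≤ δ + γ := by
    intro y
    by_contra! hc
    exact hBno y (HN1 η (by omega) _ hc.le)
  have hBav : δ - γ ≤ av (fun y => dens (B y)) := by
    unfold dens
    rw [av_comm]
    exact le_av fun x => h2 (sup V x)
  have hDav : θ / 2 ≤ av (fun y => dens {x | ∀ a, fil a x ∈ B y}) := by
    unfold dens
    rw [av_comm]
    have hx : ∀ x : η → Option α, θ * (1 - ind (∀ e, x e ≠ none)) ≤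
        av (fun y => ind (x ∈ {x | ∀ a, fil a x ∈ B y})) := by
      intro x
      by_cases hn : ∃ e, x e = none
      · have := hV x hn
        rw [decide_eq_true_iff] at this
        rw [ind_false (by push Not; exact hn), sub_zero, mul_one]
        refine this.trans (av_mono fun y => ind_mono fun hh a => ?_)
        have := hh a
        rw [fil_sup] at this
        exact this
      · push Not at hn
        rw [ind_true hn, sub_self, mul_zero]
        exact av_nonneg fun _ => ind_nonneg _
    refine le_trans ?_ (av_mono hx)
    rw [av_mul, av_sub, av_const]
    have := Hn3 η (by omega)
    have h6 : av (fun x : η → Option α => ind (∀ e, x e ≠ none)) ≤ 1 / 2 := this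
    nlinarith
  obtain ⟨y, hy1, hy2⟩ := choose_y (fun y => dens (B y)) (fun y => dens {x | ∀ a, fil a x ∈ B y}) δ θ ρ hρ0 hθ hθ1
    hBav hDav hB1 (fun y => dens_le_one _)
  exact Hend η (by omega) (B y) (hBno y) hy2 hy1

lemma dhj_step (α : Type) [Finite α] [Nonempty α] (hα : ∀ δ > 0, Good α δ) : ∀ δ > 0, Good (Option α) δ := by
  intro δ1 hδ1
  by_contra hbad
  have hmono : ∀ a b, a ≤ b → Good (Option α) a → Good (Option α) b := by
    rintro a b hab ⟨N, HN⟩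
    exact ⟨N, fun ι _ hι A hA => HN ι hι A (hab.trans hA)⟩
  let S : Set ℝ := {δ | 0 < δ ∧ Good (Option α) δ}
  have hne : S.Nonempty := ⟨2, by norm_num, 0, fun ι _ _ A hA => by
    have := dens_le_one A
    linarith⟩
  have hlb : ∀ s ∈ S, δ1 ≤ s := by
    rintro s ⟨hs, hg⟩
    by_contra! hc
    exact hbad (hmono _ _ hc.le hg)
  have hbdd : BddBelow S := ⟨δ1, hlb⟩
  have hpos : 0 < sInf S := hδ1.trans_le (le_csInf hne hlb)
  obtain ⟨ε0, h0, h1, hg⟩ := core α hα (sInf S) hpos (fun ε hε => by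
    obtain ⟨s, hs, hlt⟩ := exists_lt_of_csInf_lt hne (show sInf S < sInf S + ε by linarith)
    exact hmono _ _ hlt.le hs.2)
  have := csInf_le hbdd (show sInf S - ε0 ∈ S from ⟨by linarith, hg⟩)
  linarith

lemma dhj_unit : ∀ δ > 0, Good (Fin 1) δ := by
  intro δ hδ
  refine ⟨1, fun ι _ hι A hA => ?_⟩
  have hne : Nonempty ι := by
    by_contra hc
    rw [not_nonempty_iff] at hc
    simp at hι
  obtain ⟨x, hx⟩ := exists_le_of_av hA
  have hxA : x ∈ A := by
    by_contra hc
    rw [ind_false hc] at hx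
    linarith
  refine ⟨⟨fun _ => none, Classical.arbitrary ι, rfl⟩, fun b => ?_⟩
  convert hxA using 1

lemma good_equiv {α β : Type} [Finite α] [Finite β] (f : α ≃ β) (δ : ℝ) (h : Good α δ) : Good β δ := by
  obtain ⟨N, HN⟩ := h
  refine ⟨N, fun ι _ hι A hA => ?_⟩
  obtain ⟨l, hl⟩ := HN ι hι {x | (fun i => f (x i)) ∈ A} (by
    unfold dens at hA ⊢
    rw [← av_equiv (Equiv.arrowCongr (Equiv.refl ι) f)] at hA
    exact hA)
  refine ⟨l.map f, fun b => ?_⟩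
  have := hl (f.symm b)
  simp only [Set.mem_setOf_eq] at this
  convert this using 1
  funext i
  have := congrFun (Line.map_apply f l (f.symm b)) i
  simpa using this

lemma dhj (k : ℕ) : ∀ δ > 0, Good (Fin (k + 1)) δ := by
  induction k with
  | zero => exact dhj_unit
  | succ k ih =>
    intro δ hδ
    exact good_equiv (finSuccEquiv (k + 1)).symm δ (dhj_step _ ih δ hδ)

end DHJ

/-- **Szemerédi's Theorem.** For any `δ > 0` and `k ≥ 1` there is `N₀ ≥ 1` such that
for all `N ≥ N₀`, every `A ⊆ {1,…,N}` with `|A| ≥ δN` contains a nontrivial `k`-term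
arithmetic progression. -/
theorem szemeredi (δ : ℝ) (hδ : 0 < δ) (k : ℕ) (hk : 1 ≤ k) :
    ∃ N₀ : ℕ, 1 ≤ N₀ ∧ ∀ N, N₀ ≤ N → ∀ A : Finset ℕ, A ⊆ Finset.Icc 1 N →
      δ * N ≤ (A.card : ℝ) →
      ∃ a ∈ Finset.Icc 1 N, ∃ n : ℕ, 1 ≤ n ∧ ∀ i < k, a + i * n ∈ A := by
  classical
  obtain ⟨k, rfl⟩ : ∃ k', k = k' + 1 := ⟨k - 1, by omega⟩
  obtain ⟨n, Hn⟩ := DHJ.dhj k (δ / 2) (by positivity)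
  set L := n * (k + 1) with hL
  refine ⟨L + 1, by omega, fun N hN A hA hd => ?_⟩
  let P : Fin (N + L + 1) → (Fin n → Fin (k + 1)) → Prop :=
    fun a x => ∃ c ∈ A, c + L = (a : ℕ) + ∑ i, (x i : ℕ)
  have hx : ∀ x, δ / 2 ≤ DHJ.av (fun a => DHJ.ind (P a x)) := by
    intro x
    have hs : ∑ i, (x i : ℕ) ≤ L := by
      calc ∑ i, (x i : ℕ) ≤ ∑ i : Fin n, (k + 1) := Finset.sum_le_sum fun i _ => (x i).2.le
        _ = L := by simp [hL]
    rw [DHJ.av_eq, le_div_iff₀ (by positivity)]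
    have hNL : ((Fintype.card (Fin (N + L + 1)) : ℕ) : ℝ) ≤ 2 * N := by
      rw [Fintype.card_fin]
      exact_mod_cast (by omega : N + L + 1 ≤ 2 * N)
    have h1 : (A.card : ℝ) ≤ ∑ a, DHJ.ind (P a x) := by
      have h2 : ∑ a, DHJ.ind (P a x) = ((Finset.univ.filter (fun a => P a x)).card : ℝ) := by
        rw [Finset.card_filter]
        push_cast
        apply Finset.sum_congr rfl
        intro a _
        unfold DHJ.ind
        congr
      rw [h2]
      norm_cast
      refine Finset.card_le_card_of_surjOn (fun a => (a : ℕ) + ∑ i, (x i : ℕ) - L) ?_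
      intro c hc
      have hcN := Finset.mem_Icc.1 (hA hc)
      refine ⟨⟨c + L - ∑ i, (x i : ℕ), by omega⟩, ?_, ?_⟩
      · simp only [Finset.coe_filter, Finset.mem_univ, true_and]
        exact ⟨c, hc, by simp only; omega⟩
      · simp only; omega
    calc δ / 2 * _ ≤ δ / 2 * (2 * N) := by gcongr
      _ = δ * N := by ring
      _ ≤ _ := hd.trans h1
  have h3 : δ / 2 ≤ DHJ.av (fun a => DHJ.av (fun x => DHJ.ind (P a x))) := by
    rw [DHJ.av_comm]
    exact DHJ.le_av hx
  obtain ⟨a, ha⟩ := DHJ.exists_le_of_av h3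
  obtain ⟨l, hl⟩ := Hn (Fin n) (by simp) {x | P a x} ha
  set d : ℕ := ∑ i, if l.idxFun i = none then 1 else 0 with hd'
  have hsum : ∀ b : Fin (k + 1), ∑ i, (l b i : ℕ) = ∑ i, (l 0 i : ℕ) + b * d := by
    intro b
    rw [hd', Finset.mul_sum, ← Finset.sum_add_distrib]
    apply Finset.sum_congr rfl
    intro i _
    rw [Combinatorics.Line.apply_def, Combinatorics.Line.apply_def]
    cases h : l.idxFun i <;> simp [h]
  have hd1 : 1 ≤ d := by
    obtain ⟨j, hj⟩ := l.proper
    have := Finset.single_le_sum (f := fun i => if l.idxFun i = none then 1 else 0)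
      (fun i _ => Nat.zero_le _) (Finset.mem_univ j)
    rw [← hd'] at this
    simp only [hj, if_true] at this
    exact this
  obtain ⟨c, hc, hc2⟩ := hl 0
  refine ⟨c, hA hc, d, hd1, fun i hi => ?_⟩
  obtain ⟨c', hc', hc2'⟩ := hl ⟨i, hi⟩
  rw [hsum] at hc2'
  have : c' = c + i * d := by
    simp only at hc2'
    omega
  rw [← this]
  exact hc'
end

section
/- Let (X,Σ,μ) be a standard Borel probability space, λ a d-fold self-coupling of μ on X^d (a measure with all 1-dimensional marginals equal to μ) with coordinate projections π_i, and (Ψ_e)_{e ∈ binom([d], ≥2)} σ-subalgebras of Σ such that: (i) e ⊆ e' implies Ψ_e ⊇ Ψ_{e'}; (ii) for i,j ∈ e and A ∈ Ψ_e, λ(π_i^{-1}(A) △ π_j^{-1}(A)) = 0, so the common λ-completion Ψ_e^† of the π_i^{-1}(Ψ_e) (i ∈ e) is well defined; (iii) for up-sets I, I' ⊆ binom([d],≥2), the σ-algebras Ψ_I^† := ⋁_{e∈I} Ψ_e^† and Ψ_{I'}^† are relatively independent under λ over Ψ_{I∩I'}^†. Then for any sets A₁ ∈ Ψ_{⟨1⟩},…,A_d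 ∈ Ψ_{⟨d⟩} (where ⟨i⟩ = {u ∈ binom([d],≥2): i ∈ u}), if λ(A₁×A₂×⋯×A_d) = 0 then μ(A₁∩A₂∩⋯∩A_d) = 0. -/
open MeasureTheory

/-- The join of the lifts of the σ-algebras `Ψ e`, `e ∈ I`, through all coordinates
`i ∈ e`: this is the σ-algebra `Ψ_I^†` of the paper (modulo null sets). -/
def obliqueLift {X : Type*} {d : ℕ} (Ψ : Finset (Fin d) → MeasurableSpace X)
    (I : Set (Finset (Fin d))) : MeasurableSpace (Fin d → X) :=
  ⨆ e ∈ I, ⨆ i ∈ e, MeasurableSpace.comap (fun x => x i) (Ψ e)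

/-- `I` is an up-set in the collection of subsets of `[d]` of size at least 2. -/
def IsUpSet {d : ℕ} (I : Set (Finset (Fin d))) : Prop :=
  (∀ e ∈ I, 2 ≤ e.card) ∧ ∀ e ∈ I, ∀ e' : Finset (Fin d), e ⊆ e' → e' ∈ I


open Set in
/-- approximation of sets in a join by sets using finitely many sets of the second algebra. -/
lemma ir_approx {X : Type*} {m1 m2 m0 : MeasurableSpace X} (μ : Measure X) [IsProbabilityMeasure μ]
    (h1 : m1 ≤ m0) (h2 : m2 ≤ m0) {A : Set X}
    (hA : MeasurableSet[m1 ⊔ m2] A) {ε : ℝ} (hε : 0 < ε) :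
    ∃ S : Finset (Set X), (∀ s ∈ S, MeasurableSet[m2] s) ∧
      ∃ A0 : Set X, MeasurableSet[m1 ⊔ MeasurableSpace.generateFrom (S : Set (Set X))] A0 ∧
        μ.real (symmDiff A A0) ≤ ε := by
  classical
  let 𝒜 : Set (Set X) := {A0 | ∃ S : Finset (Set X), (∀ s ∈ S, MeasurableSet[m2] s) ∧
    MeasurableSet[m1 ⊔ MeasurableSpace.generateFrom (S : Set (Set X))] A0}
  have hmono : ∀ S T : Finset (Set X), S ⊆ T →
      m1 ⊔ MeasurableSpace.generateFrom (S : Set (Set X)) ≤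
      m1 ⊔ MeasurableSpace.generateFrom (T : Set (Set X)) := fun S T h =>
    sup_le_sup_left (MeasurableSpace.generateFrom_mono (by exact_mod_cast h)) _
  have hgle : ∀ S : Finset (Set X), (∀ s ∈ S, MeasurableSet[m2] s) →
      m1 ⊔ MeasurableSpace.generateFrom (S : Set (Set X)) ≤ m1 ⊔ m2 := fun S h =>
    sup_le_sup_left (MeasurableSpace.generateFrom_le (by simpa using h)) _
  have halg : IsSetAlgebra 𝒜 := by
    refine ⟨⟨∅, by simp, @MeasurableSet.empty _ (_)⟩, ?_, ?_⟩
    · rintro s ⟨S, hS, hs⟩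
      exact ⟨S, hS, hs.compl⟩
    · rintro s t ⟨S, hS, hs⟩ ⟨T, hT, ht⟩
      refine ⟨S ∪ T, ?_, ?_⟩
      · intro u hu
        rcases Finset.mem_union.1 hu with h | h
        exacts [hS u h, hT u h]
      · exact MeasurableSet.union (hmono _ _ Finset.subset_union_left _ hs)
          (hmono _ _ Finset.subset_union_right _ ht)
  have hgen : m1 ⊔ m2 = MeasurableSpace.generateFrom 𝒜 := by
    apply le_antisymm
    · refine sup_le (fun s hs => ?_) (fun s hs => ?_)
      · exact MeasurableSpace.measurableSet_generateFrom
          ⟨∅, by simp, (le_sup_left : m1 ≤ _) _ hs⟩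
      · refine MeasurableSpace.measurableSet_generateFrom ⟨{s}, by simpa using hs, ?_⟩
        exact (le_sup_right : MeasurableSpace.generateFrom _ ≤ _) _
          (MeasurableSpace.measurableSet_generateFrom (by simp))
    · refine MeasurableSpace.generateFrom_le ?_
      rintro t ⟨S, hS, ht⟩
      exact hgle S hS _ ht
  have hle : m1 ⊔ m2 ≤ m0 := sup_le h1 h2
  have hd := @Measure.MeasureDense.of_generateFrom_isSetAlgebra_finite X (m1 ⊔ m2) (μ.trim hle) 𝒜
    _ halg hgen
  obtain ⟨t, ⟨S, hS, ht⟩, hlt⟩ := @Measure.MeasureDense.approx X (m1 ⊔ m2) _ _ hd A hA (@measure_ne_top _ (m1 ⊔ m2) _ _ _) ε hε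
  refine ⟨S, hS, t, ht, ?_⟩
  have hm : MeasurableSet[m1 ⊔ m2] (symmDiff A t) :=
    @MeasurableSet.symmDiff _ (_) _ _ hA (hgle S hS _ ht)
  rw [trim_measurableSet_eq hle hm] at hlt
  rw [measureReal_def]
  exact ENNReal.toReal_le_of_le_ofReal hε.le hlt.le

def irAtom {X : Type*} (S T : Finset (Set X)) : Set X := {x | ∀ s ∈ S, x ∈ s ↔ s ∈ T}

lemma irAtom_meas {X : Type*} {m : MeasurableSpace X} {S : Finset (Set X)} (T : Finset (Set X))
    (hS : ∀ s ∈ S, MeasurableSet s) : MeasurableSet (irAtom S T) := by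
  have : irAtom S T = ⋂ s ∈ S, {x | x ∈ s ↔ s ∈ T} := by ext; simp [irAtom]
  rw [this]
  refine Finset.measurableSet_biInter _ fun s hs => ?_
  by_cases h : s ∈ T
  · simpa [h] using hS s hs
  · have := (hS s hs).compl
    simp only [h, iff_false]
    exact this

lemma irAtom_cover {X : Type*} (S : Finset (Set X)) (x : X) :
    ∃ T ∈ S.powerset, x ∈ irAtom S T := by
  classical
  exact ⟨S.filter (fun s => x ∈ s), by simp, by intro s hs; simp [hs]⟩

lemma irAtom_disj {X : Type*} (S : Finset (Set X)) :
    (S.powerset : Set (Finset (Set X))).PairwiseDisjoint (irAtom S) := by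
  intro T hT T' hT' hne
  refine Set.disjoint_left.2 fun x hx hx' => hne ?_
  have hT : T ⊆ S := by simpa using hT
  have hT' : T' ⊆ S := by simpa using hT'
  ext s
  constructor
  · intro h; exact (hx' s (hT h)).1 ((hx s (hT h)).2 h)
  · intro h; exact (hx s (hT' h)).1 ((hx' s (hT' h)).2 h)

lemma irAtom_restrict {X : Type*} {m1 : MeasurableSpace X} (S T : Finset (Set X)) {A : Set X}
    (hA : MeasurableSet[m1 ⊔ MeasurableSpace.generateFrom (S : Set (Set X))] A) :
    ∃ Q, MeasurableSet[m1] Q ∧ ∀ x ∈ irAtom S T, x ∈ A ↔ x ∈ Q := by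
  let m' : MeasurableSpace X :=
    { MeasurableSet' := fun A => ∃ Q, MeasurableSet[m1] Q ∧ ∀ x ∈ irAtom S T, x ∈ A ↔ x ∈ Q
      measurableSet_empty := ⟨∅, by simp, by simp⟩
      measurableSet_compl := by
        rintro A ⟨Q, hQ, h⟩
        exact ⟨Qᶜ, hQ.compl, fun x hx => not_congr (h x hx)⟩
      measurableSet_iUnion := by
        intro f hf
        choose Q hQ h using hf
        refine ⟨⋃ i, Q i, MeasurableSet.iUnion hQ, fun x hx => ?_⟩
        simp only [Set.mem_iUnion]
        exact exists_congr fun i => h i x hx }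
  have : m1 ⊔ MeasurableSpace.generateFrom (S : Set (Set X)) ≤ m' := by
    refine sup_le (fun s hs => ⟨s, hs, fun _ _ => Iff.rfl⟩) (MeasurableSpace.generateFrom_le ?_)
    intro s hs
    by_cases h : s ∈ T
    · exact ⟨Set.univ, @MeasurableSet.univ _ m1, fun x hx => by simp [hx s hs, h]⟩
    · exact ⟨∅, @MeasurableSet.empty _ m1, fun x hx => by simp [hx s hs, h]⟩
  exact this A hA

lemma irAtom_sum {X : Type*} [MeasurableSpace X] (μ : Measure X) [IsProbabilityMeasure μ]
    {S : Finset (Set X)} (hS : ∀ s ∈ S, MeasurableSet s) {Y : Set X} :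
    ∑ T ∈ S.powerset, μ.real (Y ∩ irAtom S T) = μ.real Y := by
  have h := measureReal_biUnion_finset (μ := μ.restrict Y) (irAtom_disj S)
    (fun T _ => irAtom_meas T hS)
  have hu : (⋃ T ∈ S.powerset, irAtom S T) = Set.univ := by
    ext x; simpa using irAtom_cover S x
  rw [hu] at h
  simp only [measureReal_restrict_apply_univ] at h
  rw [h]
  refine Finset.sum_congr rfl fun T _ => ?_
  rw [measureReal_restrict_apply (irAtom_meas T hS), Set.inter_comm]

/-- indicator cond prob -/
noncomputable def irCP {X : Type*} (F : MeasurableSpace X) {m0 : MeasurableSpace X} (μ : Measure X)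
    (A : Set X) : X → ℝ := μ[A.indicator (fun _ => (1 : ℝ)) | F]

lemma irCP_meas {X : Type*} (F : MeasurableSpace X) {m0 : MeasurableSpace X} (μ : Measure X)
    (A : Set X) : Measurable[F] (irCP F μ A) := stronglyMeasurable_condExp.measurable

lemma irCP_int {X : Type*} (F : MeasurableSpace X) {m0 : MeasurableSpace X} (μ : Measure X)
    (A : Set X) : Integrable (irCP F μ A) μ := integrable_condExp

lemma irCP_nonneg {X : Type*} (F : MeasurableSpace X) {m0 : MeasurableSpace X} (μ : Measure X)
    (A : Set X) : 0 ≤ᵐ[μ] irCP F μ A :=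
  condExp_nonneg (Filter.Eventually.of_forall (Set.indicator_nonneg (by simp)))

lemma irCP_set {X : Type*} {F m0 : MeasurableSpace X} (μ : Measure X) [IsProbabilityMeasure μ]
    (hF : F ≤ m0) {A Q : Set X} (hA : MeasurableSet A)
    (hQ : MeasurableSet[F] Q) : ∫ x in Q, irCP F μ A x ∂μ = μ.real (A ∩ Q) := by
  unfold irCP
  rw [setIntegral_condExp hF ((integrable_const _).indicator hA) hQ, integral_indicator hA]
  simp [hA, measureReal_restrict_apply]

def irC {X : Type*} (F : MeasurableSpace X) {m0 : MeasurableSpace X} (μ : Measure X)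
    (δ : ℝ) (A a : Set X) : Set X := {x | irCP F μ (a \ A) x ≤ δ * irCP F μ a x}

lemma irC_meas {X : Type*} (F : MeasurableSpace X) {m0 : MeasurableSpace X} (μ : Measure X)
    (δ : ℝ) (A a : Set X) : MeasurableSet[F] (irC F μ δ A a) :=
  @measurableSet_le _ _ _ _ _ F _ _ _ _ _ (irCP_meas F μ _) ((irCP_meas F μ _).const_mul δ)

lemma ir_bound {X : Type*} {m1 m2 m0 : MeasurableSpace X} (μ : Measure X) [IsProbabilityMeasure μ]
    (h1 : m1 ≤ m0) (h2 : m2 ≤ m0) {A : Set X}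
    (hA : MeasurableSet[m1 ⊔ m2] A) {δ ε : ℝ} (hδ : 0 < δ) (hε : 0 < ε) :
    ∃ S : Finset (Set X), (∀ s ∈ S, MeasurableSet[m2] s) ∧
      ∀ S' : Finset (Set X), S ⊆ S' → (∀ s ∈ S', MeasurableSet[m2] s) →
      ∑ T ∈ S'.powerset, μ.real ((A \ irC m1 μ δ A (irAtom S' T)) ∩ irAtom S' T) ≤ ε := by
  obtain ⟨S, hS, A0, hA0, hlt⟩ := ir_approx μ h1 h2 hA (ε := ε / (1 + δ⁻¹)) (by positivity)
  have hAm : MeasurableSet A := sup_le h1 h2 _ hA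
  refine ⟨S, hS, fun S' hSS hS' => ?_⟩
  have hA0' : MeasurableSet[m1 ⊔ MeasurableSpace.generateFrom (S' : Set (Set X))] A0 :=
    sup_le_sup_left (MeasurableSpace.generateFrom_mono (by exact_mod_cast hSS)) _ _ hA0
  have hS0 : ∀ s ∈ S', MeasurableSet s := fun s hs => h2 _ (hS' s hs)
  have key : ∀ T ∈ S'.powerset, μ.real ((A \ irC m1 μ δ A (irAtom S' T)) ∩ irAtom S' T) ≤
      (1 + δ⁻¹) * μ.real (symmDiff A A0 ∩ irAtom S' T) := by
    intro T _
    obtain ⟨Q, hQ, hQA⟩ := irAtom_restrict S' T hA0'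
    set a := irAtom S' T
    have ha : MeasurableSet a := irAtom_meas T hS0
    set C := irC m1 μ δ A a
    have hC : MeasurableSet[m1] C := irC_meas _ _ _ _ _
    have hQC : MeasurableSet[m1] (Q \ C) := hQ.diff hC
    have e1 : μ.real ((A \ C) ∩ a) ≤ μ.real (symmDiff A A0 ∩ a) + μ.real (a ∩ (Q \ C)) := by
      refine (measureReal_mono ?_).trans (measureReal_union_le _ _)
      rintro x ⟨⟨hxA, hxC⟩, hxa⟩
      by_cases hx : x ∈ Q
      · exact Or.inr ⟨hxa, hx, hxC⟩
      · exact Or.inl ⟨Or.inl ⟨hxA, fun h => hx ((hQA x hxa).1 h)⟩, hxa⟩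
    have e2 : δ * μ.real (a ∩ (Q \ C)) ≤ μ.real (symmDiff A A0 ∩ a) := by
      rw [← irCP_set μ h1 ha hQC, ← integral_const_mul]
      calc _ ≤ ∫ x in Q \ C, irCP m1 μ (a \ A) x ∂μ := by
            refine setIntegral_mono_on ((irCP_int _ _ _).const_mul δ).integrableOn
              (irCP_int _ _ _).integrableOn (h1 _ hQC) ?_
            rintro x ⟨_, hx⟩
            exact (not_le.1 hx).le
        _ = μ.real ((a \ A) ∩ (Q \ C)) := irCP_set μ h1 (ha.diff hAm) hQC
        _ ≤ _ := by
            refine measureReal_mono ?_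
            rintro x ⟨⟨hxa, hxA⟩, hxQ, _⟩
            exact ⟨Or.inr ⟨(hQA x hxa).2 hxQ, hxA⟩, hxa⟩
    have e3 : μ.real (a ∩ (Q \ C)) ≤ δ⁻¹ * μ.real (symmDiff A A0 ∩ a) := by
      rw [inv_mul_eq_div, le_div_iff₀ hδ, mul_comm]; exact e2
    linarith
  calc _ ≤ ∑ T ∈ S'.powerset, (1 + δ⁻¹) * μ.real (symmDiff A A0 ∩ irAtom S' T) :=
        Finset.sum_le_sum key
    _ = (1 + δ⁻¹) * μ.real (symmDiff A A0) := by
        rw [← Finset.mul_sum, irAtom_sum μ hS0]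
    _ ≤ (1 + δ⁻¹) * (ε / (1 + δ⁻¹)) := by gcongr
    _ = ε := by field_simp

/-- join of the `Ψ e` downstairs -/
@[reducible] def irF {X : Type*} {d : ℕ} (Ψ : Finset (Fin d) → MeasurableSpace X)
    (I : Set (Finset (Fin d))) : MeasurableSpace X := ⨆ e ∈ I, Ψ e

def irUp {d : ℕ} (U : Set (Finset (Fin d))) (i : Fin d) : Set (Finset (Fin d)) :=
  {e | e ∈ U ∧ i ∈ e}

lemma irF_le {X : Type*} {d : ℕ} {Ψ : Finset (Fin d) → MeasurableSpace X}
    {m0 : MeasurableSpace X} (hle : ∀ e, 2 ≤ e.card → Ψ e ≤ m0)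
    {I : Set (Finset (Fin d))} (hI : ∀ e ∈ I, 2 ≤ e.card) : irF Ψ I ≤ m0 :=
  iSup₂_le fun e he => hle e (hI e he)

lemma obl_le {X : Type*} {d : ℕ} {Ψ : Finset (Fin d) → MeasurableSpace X}
    {m0 : MeasurableSpace X} (hle : ∀ e, 2 ≤ e.card → Ψ e ≤ m0)
    {I : Set (Finset (Fin d))} (hI : ∀ e ∈ I, 2 ≤ e.card) :
    obliqueLift Ψ I ≤ MeasurableSpace.pi :=
  iSup₂_le fun e he => iSup₂_le fun i _ => by
    rintro _ ⟨B, hB, rfl⟩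
    exact measurable_pi_apply i (hle e (hI e he) _ hB)

lemma comap_le_obl {X : Type*} {d : ℕ} {Ψ : Finset (Fin d) → MeasurableSpace X}
    {I : Set (Finset (Fin d))} {i : Fin d} (hI : ∀ e ∈ I, i ∈ e) :
    MeasurableSpace.comap (fun x : Fin d → X => x i) (irF Ψ I) ≤ obliqueLift Ψ I := by
  rw [irF, MeasurableSpace.comap_iSup]
  refine iSup_le fun e => ?_
  rw [MeasurableSpace.comap_iSup]
  refine iSup_le fun he => ?_
  exact le_iSup₂_of_le e he (le_iSup₂_of_le i (hI e he) le_rfl)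

lemma obl_mono {X : Type*} {d : ℕ} {Ψ : Finset (Fin d) → MeasurableSpace X}
    {I J : Set (Finset (Fin d))} (h : I ⊆ J) : obliqueLift Ψ I ≤ obliqueLift Ψ J :=
  biSup_mono h

lemma ir_lift_ae {X : Type*} [m0 : MeasurableSpace X]
    {d : ℕ} (lm : Measure (Fin d → X))
    (Ψ : Finset (Fin d) → MeasurableSpace X)
    (hdiag : ∀ e : Finset (Fin d), 2 ≤ e.card → ∀ i ∈ e, ∀ j ∈ e,
      ∀ A : Set X, MeasurableSet[Ψ e] A →
        lm (symmDiff ((fun x => x i) ⁻¹' A) ((fun x => x j) ⁻¹' A)) = 0)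
    {I : Set (Finset (Fin d))} (hI : ∀ e ∈ I, 2 ≤ e.card) {i : Fin d} (hi : ∀ e ∈ I, i ∈ e)
    {Y : Set (Fin d → X)} (hY : MeasurableSet[obliqueLift Ψ I] Y) :
    ∃ Q, MeasurableSet[irF Ψ I] Q ∧ Y =ᵐ[lm] ((fun x => x i) ⁻¹' Q : Set (Fin d → X)) := by
  have : obliqueLift Ψ I ≤ eventuallyMeasurableSpace
      (MeasurableSpace.comap (fun x : Fin d → X => x i) (irF Ψ I)) (ae lm) := by
    refine iSup₂_le fun e he => iSup₂_le fun j hj => ?_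
    rintro _ ⟨B, hB, rfl⟩
    refine ⟨(fun x => x i) ⁻¹' B, ⟨B, ?_, rfl⟩, ?_⟩
    · exact (le_iSup₂_of_le e he le_rfl : Ψ e ≤ irF Ψ I) _ hB
    · exact measure_symmDiff_eq_zero_iff.1 (hdiag e (hI e he) j hj i (hi e he) B hB)
  obtain ⟨_, ⟨Q, hQ, rfl⟩, h⟩ := this Y hY
  exact ⟨Q, hQ, h⟩

lemma ir_condExp {X : Type*} [m0 : MeasurableSpace X] (μ : Measure X) [IsProbabilityMeasure μ]
    {d : ℕ} (lm : Measure (Fin d → X)) [IsProbabilityMeasure lm]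
    (hmarg : ∀ i : Fin d, lm.map (fun x => x i) = μ)
    (Ψ : Finset (Fin d) → MeasurableSpace X)
    (hle : ∀ e, 2 ≤ e.card → Ψ e ≤ m0)
    (hdiag : ∀ e : Finset (Fin d), 2 ≤ e.card → ∀ i ∈ e, ∀ j ∈ e,
      ∀ A : Set X, MeasurableSet[Ψ e] A →
        lm (symmDiff ((fun x => x i) ⁻¹' A) ((fun x => x j) ⁻¹' A)) = 0)
    {I : Set (Finset (Fin d))} (hI : ∀ e ∈ I, 2 ≤ e.card) {i : Fin d} (hi : ∀ e ∈ I, i ∈ e)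
    {D : Set X} (hD : MeasurableSet[m0] D) :
    (fun x => irCP (irF Ψ I) μ D (x i)) =ᵐ[lm]
      lm[Set.indicator ((fun x : Fin d → X => x i) ⁻¹' D) (fun _ => (1 : ℝ)) | obliqueLift Ψ I] := by
  have hmp : MeasurePreserving (fun x : Fin d → X => x i) lm μ :=
    ⟨measurable_pi_apply i, hmarg i⟩
  have hDi : MeasurableSet ((fun x : Fin d → X => x i) ⁻¹' D) := hmp.measurable hD
  have hint : Integrable (fun x : Fin d → X => irCP (irF Ψ I) μ D (x i)) lm :=
    hmp.integrable_comp_of_integrable (irCP_int _ _ _)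
  have hF := irF_le hle hI
  refine ae_eq_condExp_of_forall_setIntegral_eq (obl_le hle hI)
    ((integrable_const _).indicator hDi) (fun _ _ _ => hint.integrableOn) ?_ ?_
  · intro Y hY _
    obtain ⟨Q, hQ, hYQ⟩ := ir_lift_ae lm Ψ hdiag hI hi hY
    have hQ0 : MeasurableSet[m0] Q := hF _ hQ
    rw [setIntegral_congr_set hYQ, setIntegral_congr_set hYQ, integral_indicator hDi]
    have e1 : ∫ x in (fun x : Fin d → X => x i) ⁻¹' Q, irCP (irF Ψ I) μ D (x i) ∂lm
        = ∫ y in Q, irCP (irF Ψ I) μ D y ∂μ := by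
      rw [← hmarg i]
      rw [setIntegral_map hQ0 ?_ hmp.measurable.aemeasurable]
      rw [hmarg i]
      exact (irCP_int _ _ _).aestronglyMeasurable
    rw [e1, irCP_set μ hF hD hQ]
    have : μ.real (D ∩ Q) = lm.real ((fun x : Fin d → X => x i) ⁻¹' (D ∩ Q)) := by
      rw [measureReal_def, measureReal_def, hmp.measure_preimage (hD.inter hQ0).nullMeasurableSet]
    rw [this]
    simp [measureReal_restrict_apply hDi]
  · have : Measurable[obliqueLift Ψ I] (fun x : Fin d → X => irCP (irF Ψ I) μ D (x i)) := by
      refine (irCP_meas (irF Ψ I) μ D).comp ?_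
      rw [measurable_iff_comap_le]
      exact comap_le_obl hi
    exact this.stronglyMeasurable.aestronglyMeasurable

lemma isUp_up {d : ℕ} {U : Set (Finset (Fin d))} (hU : IsUpSet U) (i : Fin d) :
    IsUpSet (irUp U i) :=
  ⟨fun e he => hU.1 e he.1, fun e he e' h => ⟨hU.2 e he.1 e' h, h he.2⟩⟩

lemma ir_key {X : Type*} [m0 : MeasurableSpace X] (μ : Measure X) [IsProbabilityMeasure μ]
    {d : ℕ} (lm : Measure (Fin d → X)) [IsProbabilityMeasure lm]
    (hmarg : ∀ i : Fin d, lm.map (fun x => x i) = μ)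
    (Ψ : Finset (Fin d) → MeasurableSpace X)
    (hle : ∀ e, 2 ≤ e.card → Ψ e ≤ m0)
    (hdiag : ∀ e : Finset (Fin d), 2 ≤ e.card → ∀ i ∈ e, ∀ j ∈ e,
      ∀ A : Set X, MeasurableSet[Ψ e] A →
        lm (symmDiff ((fun x => x i) ⁻¹' A) ((fun x => x j) ⁻¹' A)) = 0)
    (hRelInd : ∀ I I' : Set (Finset (Fin d)), IsUpSet I → IsUpSet I' →
      ∀ A B : Set (Fin d → X),
        MeasurableSet[obliqueLift Ψ I] A → MeasurableSet[obliqueLift Ψ I'] B →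
        ∫ x, Set.indicator A (fun _ => (1 : ℝ)) x *
             Set.indicator B (fun _ => (1 : ℝ)) x ∂lm =
        ∫ x, (lm[Set.indicator A (fun _ => (1 : ℝ))|obliqueLift Ψ (I ∩ I')]) x *
             (lm[Set.indicator B (fun _ => (1 : ℝ))|obliqueLift Ψ (I ∩ I')]) x ∂lm)
    {U U' : Set (Finset (Fin d))} (hU : IsUpSet U) (hU' : IsUpSet U') (hUU : U' ⊆ U)
    (i : Fin d) {D : Set X} (hD : MeasurableSet[irF Ψ (irUp U i)] D)
    {H : Set (Fin d → X)} (hH : MeasurableSet[obliqueLift Ψ U'] H) :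
    ∫ x in H, irCP (irF Ψ (irUp U' i)) μ D (x i) ∂lm =
      lm.real (H ∩ (fun x => x i) ⁻¹' D) := by
  have hD0 : MeasurableSet[m0] D := irF_le hle (isUp_up hU i).1 _ hD
  have hDi : MeasurableSet ((fun x : Fin d → X => x i) ⁻¹' D) := measurable_pi_apply i hD0
  have hH0 : MeasurableSet H := obl_le hle hU'.1 _ hH
  have hDl : MeasurableSet[obliqueLift Ψ (irUp U i)] ((fun x : Fin d → X => x i) ⁻¹' D) :=
    comap_le_obl (fun e he => he.2) _ ⟨D, hD, rfl⟩
  have h := hRelInd U' (irUp U i) hU' (isUp_up hU i) H _ hH hDl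
  have hI : U' ∩ irUp U i = irUp U' i := by
    ext e; constructor
    · rintro ⟨a, b⟩; exact ⟨a, b.2⟩
    · rintro ⟨a, b⟩; exact ⟨a, hUU a, b⟩
  rw [hI] at h
  have hc := ir_condExp μ lm hmarg Ψ hle hdiag (isUp_up hU' i).1 (fun e he => he.2) hD0 (i := i)
  have hm := obl_le hle (isUp_up hU' i).1
  set m := obliqueLift Ψ (irUp U' i)
  set f : (Fin d → X) → ℝ := H.indicator (fun _ => (1 : ℝ))
  set g := lm[Set.indicator ((fun x : Fin d → X => x i) ⁻¹' D) (fun _ => (1 : ℝ)) | m] with hg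
  have hf : Integrable f lm := (integrable_const _).indicator hH0
  have hfg : f * g = H.indicator g := by
    ext x; by_cases hx : x ∈ H <;> simp [f, hx]
  have hfgi : Integrable (f * g) lm := by
    rw [hfg]; exact integrable_condExp.indicator hH0
  have h2 := condExp_mul_of_stronglyMeasurable_right (m := m) (μ := lm) (f := f) (g := g)
    stronglyMeasurable_condExp hfgi hf
  have h3 : ∫ x, (lm[f | m]) x * g x ∂lm = ∫ x in H, g x ∂lm := by
    rw [← integral_indicator hH0, ← hfg, ← integral_condExp hm (f := f * g)]
    exact (integral_congr_ae h2).symm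
  rw [h3] at h
  rw [integral_congr_ae (ae_restrict_of_ae hc), ← h]
  have : (fun x => f x * Set.indicator ((fun x : Fin d → X => x i) ⁻¹' D) (fun _ => (1 : ℝ)) x) =
      (H ∩ (fun x : Fin d → X => x i) ⁻¹' D).indicator (fun _ => (1 : ℝ)) := by
    ext x
    rw [← Set.inter_indicator_mul]; simp
  rw [this, integral_indicator (hH0.inter hDi)]
  simp

lemma ir_atom_step {X : Type*} [m0 : MeasurableSpace X] (μ : Measure X) [IsProbabilityMeasure μ]
    {d : ℕ} (lm : Measure (Fin d → X)) [IsProbabilityMeasure lm]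
    (Ψ : Finset (Fin d) → MeasurableSpace X)
    (hle : ∀ e, 2 ≤ e.card → Ψ e ≤ m0)
    (hmarg : ∀ i : Fin d, lm.map (fun x => x i) = μ)
    (hdiag : ∀ e : Finset (Fin d), 2 ≤ e.card → ∀ i ∈ e, ∀ j ∈ e,
      ∀ A : Set X, MeasurableSet[Ψ e] A →
        lm (symmDiff ((fun x => x i) ⁻¹' A) ((fun x => x j) ⁻¹' A)) = 0)
    {U U' : Set (Finset (Fin d))} (hU : IsUpSet U) (hU' : IsUpSet U')
    (hkey : ∀ (i : Fin d) (D : Set X), MeasurableSet[irF Ψ (irUp U i)] D →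
      ∀ H : Set (Fin d → X), MeasurableSet[obliqueLift Ψ U'] H →
      ∫ x in H, irCP (irF Ψ (irUp U' i)) μ D (x i) ∂lm = lm.real (H ∩ (fun x => x i) ⁻¹' D))
    (e0 : Finset (Fin d)) (he0 : e0 ∈ U) (hUe : ∀ e ∈ U, e ≠ e0 → e ∈ U')
    (hS : ∀ C : Fin d → Set X, (∀ i, MeasurableSet[irF Ψ (irUp U' i)] (C i)) →
      lm {x | ∀ i, x i ∈ C i} = 0 → μ (⋂ i, C i) = 0)
    (A : Fin d → Set X) (hA : ∀ i, MeasurableSet[irF Ψ (irUp U i)] (A i))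
    (hzero : lm {x | ∀ i, x i ∈ A i} = 0)
    {a : Set X} (ha : MeasurableSet[Ψ e0] a) :
    μ (⋂ i, (if i ∈ e0 then irC (irF Ψ (irUp U' i)) μ (1 / (d + 1)) (A i) a else A i) ∩ a) = 0 := by
  set δ : ℝ := 1 / (d + 1) with hδ
  set C : Fin d → Set X :=
    fun i => if i ∈ e0 then irC (irF Ψ (irUp U' i)) μ δ (A i) a else A i with hCdef
  have hcard : 2 ≤ e0.card := hU.1 e0 he0
  obtain ⟨i0, hi0⟩ : e0.Nonempty := Finset.card_pos.1 (by omega)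
  have ha0 : MeasurableSet[m0] a := hle e0 hcard _ ha
  have hC : ∀ i, MeasurableSet[irF Ψ (irUp U' i)] (C i) := by
    intro i
    by_cases hi : i ∈ e0
    · simp only [hCdef, hi, if_true]
      exact irC_meas _ _ _ _ _
    · simp only [hCdef, hi, if_false]
      have : irF Ψ (irUp U i) ≤ irF Ψ (irUp U' i) := by
        refine biSup_mono fun e he => ⟨hUe e he.1 ?_, he.2⟩
        rintro rfl; exact hi he.2
      exact this _ (hA i)
  have hCpre : ∀ (C : Fin d → Set X), (∀ i, MeasurableSet[irF Ψ (irUp U' i)] (C i)) →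
      MeasurableSet[obliqueLift Ψ U'] {x | ∀ i, x i ∈ C i} := by
    intro C hC
    rw [Set.setOf_forall]
    refine MeasurableSet.iInter fun i => ?_
    exact obl_mono (fun e he => he.1) _
      (comap_le_obl (I := irUp U' i) (i := i) (fun e he => he.2) _ ⟨C i, hC i, rfl⟩)
  set H : Set (Fin d → X) := {x | ∀ i, x i ∈ C i} with hHdef
  have hH := hCpre C hC
  have hH0 : MeasurableSet H := obl_le hle hU'.1 _ hH
  have hF : ∀ i, irF Ψ (irUp U' i) ≤ m0 := fun i => irF_le hle (isUp_up hU' i).1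
  have haF : ∀ i ∈ e0, MeasurableSet[irF Ψ (irUp U i)] a := fun i hi =>
    (le_iSup₂_of_le e0 ⟨he0, hi⟩ le_rfl : Ψ e0 ≤ irF Ψ (irUp U i)) _ ha
  have hmp : ∀ i, MeasurePreserving (fun x : Fin d → X => x i) lm μ := fun i =>
    ⟨measurable_pi_apply i, hmarg i⟩
  have hint : ∀ i (D : Set X),
      Integrable (fun x : Fin d → X => irCP (irF Ψ (irUp U' i)) μ D (x i)) lm := fun i D =>
    (hmp i).integrable_comp_of_integrable (irCP_int _ _ _)
  set G : Set (Fin d → X) := H ∩ (fun x => x i0) ⁻¹' a with hG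
  have hGi : ∀ i ∈ e0, lm.real (H ∩ (fun x => x i) ⁻¹' a) = lm.real G := by
    intro i hi
    refine measureReal_congr ?_
    exact Filter.EventuallyEq.rfl.inter
      (measure_symmDiff_eq_zero_iff.1 (hdiag e0 hcard i hi i0 hi0 a ha))
  have hb : ∀ i ∈ e0, lm.real (H ∩ (fun x => x i) ⁻¹' (a \ A i)) ≤ δ * lm.real G := by
    intro i hi
    have hd : MeasurableSet[irF Ψ (irUp U i)] (a \ A i) := (haF i hi).diff (hA i)
    rw [← hGi i hi, ← hkey i _ hd H hH, ← hkey i _ (haF i hi) H hH, ← integral_const_mul]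
    refine setIntegral_mono_on (hint _ _).integrableOn ((hint _ _).const_mul δ).integrableOn hH0 ?_
    intro x hx
    have := hx i
    simp only [hCdef, hi, if_true] at this
    exact this
  have hG0 : lm.real G = 0 := by
    have hsub : G ⊆ {x | ∀ i, x i ∈ A i} ∪ ⋃ i ∈ e0,
        ((H ∩ (fun x => x i) ⁻¹' (a \ A i)) ∪
          symmDiff ((fun x => x i0) ⁻¹' a) ((fun x => x i) ⁻¹' a)) := by
      rintro x ⟨hxH, hxa⟩
      by_cases hx : ∀ i, x i ∈ A i
      · exact Or.inl hx
      · push Not at hx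
        obtain ⟨i, hi⟩ := hx
        have hie : i ∈ e0 := by
          by_contra hie
          have := hxH i
          simp only [hCdef, hie, if_false] at this
          exact hi this
        refine Or.inr (Set.mem_iUnion₂.2 ⟨i, hie, ?_⟩)
        by_cases hxi : x i ∈ a
        · exact Or.inl ⟨hxH, hxi, hi⟩
        · exact Or.inr (Or.inl ⟨hxa, hxi⟩)
    have h1 : lm.real G ≤ ∑ i ∈ e0, δ * lm.real G := by
      refine (measureReal_mono hsub).trans ((measureReal_union_le _ _).trans ?_)
      have : lm.real {x | ∀ i, x i ∈ A i} = 0 := by rw [measureReal_def, hzero]; rfl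
      rw [this, zero_add]
      refine (measureReal_biUnion_finset_le _ _).trans (Finset.sum_le_sum fun i hi => ?_)
      refine (measureReal_union_le _ _).trans ?_
      have : lm.real (symmDiff ((fun x : Fin d → X => x i0) ⁻¹' a) ((fun x => x i) ⁻¹' a)) = 0 := by
        rw [measureReal_def, hdiag e0 hcard i0 hi0 i hi a ha]; rfl
      rw [this, add_zero]
      exact hb i hi
    rw [Finset.sum_const, nsmul_eq_mul] at h1
    have h2 : (e0.card : ℝ) ≤ d := by
      have := Finset.card_le_univ e0
      rw [Fintype.card_fin] at this
      exact_mod_cast this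
    have h3 : (0 : ℝ) ≤ lm.real G := measureReal_nonneg
    have h4 : (e0.card : ℝ) * (δ * lm.real G) ≤ d * (δ * lm.real G) := by gcongr
    have h5 : (d : ℝ) * (δ * lm.real G) = lm.real G - δ * lm.real G := by
      rw [hδ]; field_simp; ring
    have h6 : 0 < δ := by positivity
    have h7 : δ * lm.real G ≤ 0 := by linarith
    nlinarith
  -- remove `a`
  set g := irCP (irF Ψ (irUp U' i0)) μ a with hgdef
  set B : Set X := {y | 0 < g y} with hB
  have hBm : MeasurableSet[irF Ψ (irUp U' i0)] B :=
    @measurableSet_lt _ _ _ _ _ (irF Ψ (irUp U' i0)) _ _ _ _ _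
      (@measurable_const _ _ _ (irF Ψ (irUp U' i0)) _) (irCP_meas _ _ _)
  have hgn : 0 ≤ᵐ[lm.restrict H] fun x => g (x i0) :=
    ae_restrict_of_ae ((hmp i0).quasiMeasurePreserving.ae (irCP_nonneg _ _ _))
  have hI0 : ∫ x in H, g (x i0) ∂lm = 0 := by rw [hkey i0 a (haF i0 hi0) H hH]; exact hG0
  rw [integral_eq_zero_iff_of_nonneg_ae hgn (hint i0 a).integrableOn] at hI0
  have hI1 : ∀ᵐ x ∂lm, x ∈ H → g (x i0) = 0 := (ae_restrict_iff' hH0).1 hI0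
  have hres := hS (fun i => C i ∩ {y | i = i0 → y ∈ B}) (by
      intro i
      by_cases hi : i = i0
      · subst hi; simpa using (hC i).inter hBm
      · simpa [hi] using hC i) (by
      refine measure_mono_null ?_ hI1
      intro x hx hx'
      have h1 : g (x i0) = 0 := hx' (fun i => (hx i).1)
      have h2 : 0 < g (x i0) := (hx i0).2 rfl
      exact h2.ne' h1)
  have hnull : μ (a ∩ Bᶜ) = 0 := by
    have h1 := irCP_set μ (hF i0) ha0 (hBm.compl)
    have h2 : ∫ x in Bᶜ, irCP (irF Ψ (irUp U' i0)) μ a x ∂μ ≤ 0 :=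
      setIntegral_nonpos (hF i0 _ hBm.compl) (fun x hx => not_lt.1 hx)
    rw [h1] at h2
    have h3 := le_antisymm h2 measureReal_nonneg
    exact (measureReal_eq_zero_iff).1 h3
  refine measure_mono_null ?_ (measure_union_null hres hnull)
  intro x hx
  have hx := Set.mem_iInter.1 hx
  by_cases hxB : x ∈ B
  · exact Or.inl (Set.mem_iInter.2 fun i => ⟨(hx i).1, fun _ => hxB⟩)
  · exact Or.inr ⟨(hx i0).2, hxB⟩

lemma ir_step {X : Type*} [m0 : MeasurableSpace X] (μ : Measure X) [IsProbabilityMeasure μ]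
    {d : ℕ} (lm : Measure (Fin d → X)) [IsProbabilityMeasure lm]
    (Ψ : Finset (Fin d) → MeasurableSpace X)
    (hle : ∀ e, 2 ≤ e.card → Ψ e ≤ m0)
    (hmarg : ∀ i : Fin d, lm.map (fun x => x i) = μ)
    (hdiag : ∀ e : Finset (Fin d), 2 ≤ e.card → ∀ i ∈ e, ∀ j ∈ e,
      ∀ A : Set X, MeasurableSet[Ψ e] A →
        lm (symmDiff ((fun x => x i) ⁻¹' A) ((fun x => x j) ⁻¹' A)) = 0)
    {U U' : Set (Finset (Fin d))} (hU : IsUpSet U) (hU' : IsUpSet U')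
    (hkey : ∀ (i : Fin d) (D : Set X), MeasurableSet[irF Ψ (irUp U i)] D →
      ∀ H : Set (Fin d → X), MeasurableSet[obliqueLift Ψ U'] H →
      ∫ x in H, irCP (irF Ψ (irUp U' i)) μ D (x i) ∂lm = lm.real (H ∩ (fun x => x i) ⁻¹' D))
    (e0 : Finset (Fin d)) (he0 : e0 ∈ U) (hUe : ∀ e ∈ U, e ≠ e0 → e ∈ U')
    (hS : ∀ C : Fin d → Set X, (∀ i, MeasurableSet[irF Ψ (irUp U' i)] (C i)) →
      lm {x | ∀ i, x i ∈ C i} = 0 → μ (⋂ i, C i) = 0)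
    (A : Fin d → Set X) (hA : ∀ i, MeasurableSet[irF Ψ (irUp U i)] (A i))
    (hzero : lm {x | ∀ i, x i ∈ A i} = 0) : μ (⋂ i, A i) = 0 := by
  classical
  have hcard : 2 ≤ e0.card := hU.1 e0 he0
  have hF : ∀ i, irF Ψ (irUp U' i) ≤ m0 := fun i => irF_le hle (isUp_up hU' i).1
  have hδ : (0 : ℝ) < 1 / (d + 1) := by positivity
  suffices h : μ.real (⋂ i, A i) ≤ 0 from
    (measureReal_eq_zero_iff).1 (le_antisymm h measureReal_nonneg)
  refine le_of_forall_pos_le_add fun ε hε => ?_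
  rw [zero_add]
  have hA' : ∀ i, MeasurableSet[irF Ψ (irUp U' i) ⊔ Ψ e0] (A i) := by
    intro i
    have : irF Ψ (irUp U i) ≤ irF Ψ (irUp U' i) ⊔ Ψ e0 := by
      refine iSup₂_le fun e he => ?_
      by_cases h : e = e0
      · subst h; exact le_sup_right
      · exact le_sup_of_le_left (le_iSup₂_of_le e ⟨hUe e he.1 h, he.2⟩ le_rfl)
    exact this _ (hA i)
  have hbd := fun i => ir_bound μ (hF i) (hle e0 hcard) (hA' i) (δ := 1 / (d + 1))
    (ε := ε / (d + 1)) hδ (by positivity)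
  choose S hSm hSb using hbd
  set S' : Finset (Set X) := Finset.univ.biUnion S with hS'
  have hS'm : ∀ s ∈ S', MeasurableSet[Ψ e0] s := by
    intro s hs
    obtain ⟨i, _, hi⟩ := Finset.mem_biUnion.1 hs
    exact hSm i s hi
  have hb := fun i => hSb i S' (Finset.subset_biUnion_of_mem S (Finset.mem_univ i)) hS'm
  have hT : ∀ T ∈ S'.powerset, μ.real ((⋂ i, A i) ∩ irAtom S' T) ≤
      ∑ i, μ.real ((A i \ irC (irF Ψ (irUp U' i)) μ (1 / (d + 1)) (A i) (irAtom S' T)) ∩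
        irAtom S' T) := by
    intro T _
    have ha : MeasurableSet[Ψ e0] (irAtom S' T) := irAtom_meas T hS'm
    have hz := ir_atom_step μ lm Ψ hle hmarg hdiag hU hU' hkey e0 he0 hUe hS A hA hzero ha
    have hsub : (⋂ i, A i) ∩ irAtom S' T ⊆
        (⋂ i, (if i ∈ e0 then irC (irF Ψ (irUp U' i)) μ (1 / (d + 1)) (A i) (irAtom S' T)
          else A i) ∩ irAtom S' T) ∪
        ⋃ i ∈ Finset.univ, ((A i \ irC (irF Ψ (irUp U' i)) μ (1 / (d + 1)) (A i) (irAtom S' T)) ∩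
        irAtom S' T) := by
      rintro x ⟨hx, hxa⟩
      have hx := Set.mem_iInter.1 hx
      by_cases h : ∃ i, x ∉ irC (irF Ψ (irUp U' i)) μ (1 / (d + 1)) (A i) (irAtom S' T)
      · obtain ⟨i, hi⟩ := h
        exact Or.inr (Set.mem_iUnion₂.2 ⟨i, Finset.mem_univ i, ⟨hx i, hi⟩, hxa⟩)
      · push Not at h
        refine Or.inl (Set.mem_iInter.2 fun i => ⟨?_, hxa⟩)
        split_ifs
        exacts [h i, hx i]
    refine (measureReal_mono hsub).trans ((measureReal_union_le _ _).trans ?_)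
    have : μ.real (⋂ i, (if i ∈ e0 then irC (irF Ψ (irUp U' i)) μ (1 / (d + 1)) (A i) (irAtom S' T)
          else A i) ∩ irAtom S' T) = 0 := by rw [measureReal_def, hz]; rfl
    rw [this, zero_add]
    exact measureReal_biUnion_finset_le _ _
  rw [← irAtom_sum μ (S := S') (fun s hs => hle e0 hcard _ (hS'm s hs))]
  refine (Finset.sum_le_sum hT).trans ?_
  rw [Finset.sum_comm]
  refine (Finset.sum_le_sum fun i _ => hb i).trans ?_
  simp only [Finset.sum_const, Finset.card_univ, Fintype.card_fin, nsmul_eq_mul]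
  rw [mul_div_assoc', div_le_iff₀ (by positivity)]
  nlinarith

/-- **Infinitary hypergraph removal** (the case used for multiple recurrence).
Given a `d`-fold self-coupling `lm` of `μ` with σ-subalgebras `Ψ_e` satisfying
monotonicity, diagonal agreement of the coordinate lifts, and relative independence
of the lifted up-set σ-algebras over their intersections, any sets `A_i ∈ Ψ_{⟨i⟩}`
with `lm(A₁ × ⋯ × A_d) = 0` satisfy `μ(A₁ ∩ ⋯ ∩ A_d) = 0`. -/
theorem infinitary_removal
    {X : Type*} [m0 : MeasurableSpace X] (μ : Measure X) [IsProbabilityMeasure μ]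
    (d : ℕ) (lm : Measure (Fin d → X)) [IsProbabilityMeasure lm]
    (hmarg : ∀ i : Fin d, lm.map (fun x => x i) = μ)
    (Ψ : Finset (Fin d) → MeasurableSpace X)
    (hle : ∀ e, 2 ≤ e.card → Ψ e ≤ m0)
    (hmono : ∀ e e' : Finset (Fin d), 2 ≤ e.card → e ⊆ e' → Ψ e' ≤ Ψ e)
    (hdiag : ∀ e : Finset (Fin d), 2 ≤ e.card → ∀ i ∈ e, ∀ j ∈ e,
      ∀ A : Set X, MeasurableSet[Ψ e] A →
        lm (symmDiff ((fun x => x i) ⁻¹' A) ((fun x => x j) ⁻¹' A)) = 0)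
    (hRelInd : ∀ I I' : Set (Finset (Fin d)), IsUpSet I → IsUpSet I' →
      ∀ A B : Set (Fin d → X),
        MeasurableSet[obliqueLift Ψ I] A → MeasurableSet[obliqueLift Ψ I'] B →
        ∫ x, Set.indicator A (fun _ => (1 : ℝ)) x *
             Set.indicator B (fun _ => (1 : ℝ)) x ∂lm =
        ∫ x, (lm[Set.indicator A (fun _ => (1 : ℝ))|obliqueLift Ψ (I ∩ I')]) x *
             (lm[Set.indicator B (fun _ => (1 : ℝ))|obliqueLift Ψ (I ∩ I')]) x ∂lm)
    (A : Fin d → Set X)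
    (hA : ∀ i : Fin d,
      MeasurableSet[⨆ (e : Finset (Fin d)) (_ : i ∈ e ∧ 2 ≤ e.card), Ψ e] (A i))
    (hzero : lm {x | ∀ i, x i ∈ A i} = 0) :
    μ (⋂ i, A i) = 0 := by
  classical
  have main : ∀ n : ℕ, ∀ U : Set (Finset (Fin d)), U.ncard = n → IsUpSet U →
      ∀ C : Fin d → Set X, (∀ i, MeasurableSet[irF Ψ (irUp U i)] (C i)) →
      lm {x | ∀ i, x i ∈ C i} = 0 → μ (⋂ i, C i) = 0 := by
    intro n
    induction n with
    | zero =>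
      intro U hUn hU C hC hz
      have hU0 : U = ∅ := (Set.ncard_eq_zero (Set.toFinite U)).1 hUn
      subst hU0
      have hC' : ∀ i, C i = ∅ ∨ C i = Set.univ := by
        intro i
        have : irF Ψ (irUp ∅ i) = ⊥ := by
          simp [irF, irUp]
        have h := hC i
        rw [this] at h
        exact MeasurableSpace.measurableSet_bot_iff.1 h
      by_cases h : ∃ i, C i = ∅
      · obtain ⟨i, hi⟩ := h
        exact measure_mono_null (Set.iInter_subset _ i) (by rw [hi]; simp)
      · push Not at h
        exfalso
        have : {x : Fin d → X | ∀ i, x i ∈ C i} = Set.univ := by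
          ext x
          simp only [Set.mem_setOf_eq, Set.mem_univ, iff_true]
          intro i
          rcases hC' i with h1 | h1
          · exact absurd h1 (h i).ne_empty
          · rw [h1]; trivial
        rw [this, measure_univ] at hz
        exact one_ne_zero hz
    | succ n ih =>
      intro U hUn hU C hC hz
      have hne : U.Nonempty := by
        rw [Set.nonempty_iff_ne_empty]; rintro rfl; simp at hUn
      obtain ⟨e0, he0, hmin⟩ := Set.exists_min_image U Finset.card (Set.toFinite U) hne
      have hU' : IsUpSet (U \ {e0}) := by
        refine ⟨fun e he => hU.1 e he.1, fun e he e' h => ⟨hU.2 e he.1 e' h, ?_⟩⟩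
        rintro rfl
        exact he.2 (Finset.eq_of_subset_of_card_le h (hmin e he.1))
      have hn : (U \ {e0}).ncard = n := by
        rw [Set.ncard_sdiff_singleton_of_mem he0, hUn]; rfl
      exact ir_step μ lm Ψ hle hmarg hdiag hU hU'
        (fun i D hD H hH => ir_key μ lm hmarg Ψ hle hdiag hRelInd hU hU' Set.diff_subset i hD hH)
        e0 he0 (fun e he h => ⟨he, h⟩) (ih _ hn hU') C hC hz
  refine main _ {e | 2 ≤ e.card} rfl
    ⟨fun e he => he, fun e he e' h => le_trans he (Finset.card_le_card h)⟩ A ?_ hzero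
  intro i
  have : (⨆ (e : Finset (Fin d)) (_ : i ∈ e ∧ 2 ≤ e.card), Ψ e) ≤
      irF Ψ (irUp {e | 2 ≤ e.card} i) :=
    iSup₂_le fun e he => le_iSup₂_of_le e ⟨he.2, he.1⟩ le_rfl
  exact this _ (hA i)
end
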